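/- Let k>1 and K ∈ C¹(H²). Assume the Melnikov function F_k^K has a stable critical point in an open set A whose closure is a compact subset of H². Then there exists ε₀>0 such that for every real ε with |ε|<ε₀ there exists an embedded (k+εK)-loop u^ε, i.e. an embedded nonconstant C² 2π-periodic solution of u'' − u₂⁻¹Γ(u') = L(u)(k+εK(u)) iu'. Moreover, every sequence ε_h → 0 admits a subsequence ε_{h_j} such that u^{ε_{h_j}} converges, uniformly on ℝ together with its first and second derivatives, to ω_{z₀} for some z₀ ∈ cl A with ∇F_k^K(z₀)=0. -/

import Mathlib

open Real MeasureTheory Filter Topology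

noncomputable section

/-- Rotation by π/2 in the plane: `iw = (-w₂, w₁)`. -/
def rot (w : ℝ × ℝ) : ℝ × ℝ := (-w.2, w.1)

/-- The Christoffel-type term `Γ(w) = (2w₁w₂, w₂² - w₁²)`. -/
def Gam (w : ℝ × ℝ) : ℝ × ℝ := (2 * w.1 * w.2, w.2 ^ 2 - w.1 ^ 2)

/-- Euclidean dot product in ℝ². -/
def dotp (v w : ℝ × ℝ) : ℝ := v.1 * w.1 + v.2 * w.2

/-- The hyperbolic length-type functional `L(u) = ((1/2π)∫₀^{2π} u₂⁻²|u'|² dt)^{1/2}`. -/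
def hypL (u : ℝ → ℝ × ℝ) : ℝ :=
  Real.sqrt ((1 / (2 * π)) * ∫ t in (0:ℝ)..(2 * π),
    ((deriv u t).1 ^ 2 + (deriv u t).2 ^ 2) / (u t).2 ^ 2)

/-- `u` is a `K`-loop in the upper half-plane model of the hyperbolic plane:
a nonconstant C² `2π`-periodic curve with values in `H²` solving
`u'' - u₂⁻¹ Γ(u') = L(u) K(u) iu'`. -/
def IsKLoop (K : (ℝ × ℝ) → ℝ) (u : ℝ → ℝ × ℝ) : Prop :=
  ContDiff ℝ 2 u ∧ Function.Periodic u (2 * π) ∧ (∀ t, 0 < (u t).2) ∧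
  (¬ ∃ c, ∀ t, u t = c) ∧
  ∀ t, deriv (deriv u) t - ((u t).2)⁻¹ • Gam (deriv u t)
      = (hypL u * K (u t)) • rot (deriv u t)

/-- A `2π`-periodic curve is embedded if it is injective modulo `2π`. -/
def IsEmbedded (u : ℝ → ℝ × ℝ) : Prop :=
  ∀ t s : ℝ, u t = u s → ∃ n : ℤ, t - s = 2 * π * (n : ℝ)

/-- `R_k = (k² - 1)^{-1/2}`. -/
def Rk (k : ℝ) : ℝ := 1 / Real.sqrt (k ^ 2 - 1)

/-- The reference loop `ω(t) = (cos t, 1/R_k) / (k - sin t)`, a parameterization of the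
hyperbolic circle of center `(0,1)` and hyperbolic radius `ρ_k = artanh(1/k)`. -/
def om (k : ℝ) (t : ℝ) : ℝ × ℝ := (cos t / (k - sin t), (1 / Rk k) / (k - sin t))

/-- The translated reference circle `ω_z(t) = (z₁ + z₂ω₁(t), z₂ω₂(t))`, a parameterization
of the hyperbolic circle of center `z` and hyperbolic radius `ρ_k`. -/
def omz (k : ℝ) (z : ℝ × ℝ) (t : ℝ) : ℝ × ℝ :=
  (z.1 + z.2 * (om k t).1, z.2 * (om k t).2)

/-- The Euclidean norm on `ℝ × ℝ`. -/
def enorm2 (w : ℝ × ℝ) : ℝ := Real.sqrt (w.1 ^ 2 + w.2 ^ 2)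

/-- The Euclidean open disk of center `c` and radius `r` in `ℝ × ℝ`. -/
def EBall (c : ℝ × ℝ) (r : ℝ) : Set (ℝ × ℝ) :=
  {p : ℝ × ℝ | (p.1 - c.1) ^ 2 + (p.2 - c.2) ^ 2 < r ^ 2}

/-- The Melnikov function `F_k^K(z) = ∫_{D^H_{ρ_k}(z)} K(p) p₂⁻² dp`, the disk
`D^H_{ρ_k}(z)` being the Euclidean disk of center `(z₁, kR_k z₂)` and radius `R_k z₂`. -/
def Fmel (k : ℝ) (K : (ℝ × ℝ) → ℝ) (z : ℝ × ℝ) : ℝ :=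
  ∫ p in EBall ((z.1, k * Rk k * z.2) : ℝ × ℝ) (Rk k * z.2), K p / p.2 ^ 2

/-- `X` has a stable critical point in the bounded open set `A`: some `C¹`-neighborhood of
`X` consists of functions having a critical point in `A`. -/
def HasStableCriticalPt (X : (ℝ × ℝ) → ℝ) (A : Set (ℝ × ℝ)) : Prop :=
  ∃ r > (0:ℝ), ∀ G : (ℝ × ℝ) → ℝ,
    (∃ U : Set (ℝ × ℝ), IsOpen U ∧ closure A ⊆ U ∧ ContDiffOn ℝ 1 G U) →
    (∀ z ∈ closure A, |G z - X z| + ‖fderiv ℝ G z - fderiv ℝ X z‖ < r) →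
    ∃ z ∈ A, fderiv ℝ G z = 0

/-- The primitive `Q(x, y) = -∫₀^y κ(x, s) ds`, so that `Q dx` is a primitive of `κ dx ∧ dy`. -/
def areaPotential (κ : ℝ × ℝ → ℝ) (p : ℝ × ℝ) : ℝ := -∫ s in (0 : ℝ)..p.2, κ (p.1, s)

lemma hasStrictFDerivAt_areaPotential {κ : ℝ × ℝ → ℝ} (hκ : ContDiff ℝ 1 κ) (p : ℝ × ℝ) :
    HasStrictFDerivAt (areaPotential κ)
      ((ContinuousLinearMap.toSpanSingleton ℝ
          (-∫ s in (0 : ℝ)..p.2, fderiv ℝ κ (p.1, s) (1, 0))).coprod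
        (ContinuousLinearMap.toSpanSingleton ℝ (-κ p))) p := by
  have hc := hκ.continuous
  have hc' : Continuous (fun z => fderiv ℝ κ z (1, 0)) :=
    (hκ.continuous_fderiv one_ne_zero).clm_apply continuous_const
  have hd := hκ.differentiable one_ne_zero
  have hpart : ∀ x y : ℝ, HasDerivAt (fun x => κ (x, y)) (fderiv ℝ κ (x, y) (1, 0)) x := by
    intro x y
    have h1 : HasDerivAt (fun x : ℝ => (x, y)) ((1 : ℝ), (0 : ℝ)) x :=
      (hasDerivAt_id x).prodMk (hasDerivAt_const x y)
    exact (hd (x, y)).hasFDerivAt.comp_hasDerivAt x h1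
  have key := hasStrictFDerivAt_uncurry_coprod (𝕜 := ℝ) (u := p)
    (f := fun x y => -∫ s in (0 : ℝ)..y, κ (x, s))
    (f₁ := fun x y => ContinuousLinearMap.toSpanSingleton ℝ
      (-∫ s in (0 : ℝ)..y, fderiv ℝ κ (x, s) (1, 0)))
    (f₂ := fun x y => ContinuousLinearMap.toSpanSingleton ℝ (-κ (x, y)))
    (Eventually.of_forall fun v => ?_) (Eventually.of_forall fun v => ?_) ?_ ?_
  · exact key
  · obtain ⟨x, y⟩ := v
    simp only [Function.HasUncurry.uncurry, id]
    obtain ⟨C, hC⟩ := ((isCompact_Icc (a := x - 1) (b := x + 1)).prod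
      (isCompact_uIcc (a := 0) (b := y))).exists_bound_of_continuousOn hc'.continuousOn
    have := intervalIntegral.hasDerivAt_integral_of_dominated_loc_of_deriv_le (μ := volume)
      (F := fun x s => κ (x, s)) (F' := fun x s => fderiv ℝ κ (x, s) (1, 0)) (x₀ := x)
      (s := Set.Icc (x - 1) (x + 1)) (a := 0) (b := y) (bound := fun _ => C)
      (Icc_mem_nhds (by linarith) (by linarith))
      (Eventually.of_forall fun x => by
        apply Continuous.aestronglyMeasurable; fun_prop)
      (by apply Continuous.intervalIntegrable; fun_prop)
      (by
        apply Continuous.aestronglyMeasurable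
        exact hc'.comp (by fun_prop : Continuous fun s : ℝ => (x, s)))
      (Eventually.of_forall fun t ht x' hx' => hC (x', t) ⟨hx', Set.uIoc_subset_uIcc ht⟩)
      (by simp)
      (Eventually.of_forall fun t _ x' _ => hpart x' t)
    exact this.2.neg.hasFDerivAt
  · obtain ⟨x, y⟩ := v
    simp only [Function.HasUncurry.uncurry, id]
    have hcx : Continuous fun s : ℝ => κ (x, s) := by fun_prop
    exact (intervalIntegral.integral_hasDerivAt_right (hcx.intervalIntegrable _ _)
      (hcx.stronglyMeasurableAtFilter _ _) hcx.continuousAt).neg.hasFDerivAt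
  · simp only [Function.HasUncurry.uncurry, id]
    apply Continuous.continuousAt
    have h2 : Continuous fun v : ℝ × ℝ => -∫ s in (0 : ℝ)..v.2, fderiv ℝ κ (v.1, s) (1, 0) := by
      apply Continuous.neg
      apply intervalIntegral.continuous_parametric_intervalIntegral_of_continuous
        (f := fun (v : ℝ × ℝ) s => fderiv ℝ κ (v.1, s) (1, 0))
      · exact hc'.comp (by fun_prop : Continuous fun w : (ℝ × ℝ) × ℝ => (w.1.1, w.2))
      · fun_prop
    exact (ContinuousLinearMap.toSpanSingletonCLE (𝕜 := ℝ) (E := ℝ)).continuous.comp h2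
  · simp only [Function.HasUncurry.uncurry, id]
    apply Continuous.continuousAt
    exact (ContinuousLinearMap.toSpanSingletonCLE (𝕜 := ℝ) (E := ℝ)).continuous.comp
      (hc.comp (by fun_prop : Continuous fun v : ℝ × ℝ => (v.1, v.2))).neg

lemma contDiff_areaPotential {κ : ℝ × ℝ → ℝ} (hκ : ContDiff ℝ 1 κ) :
    ContDiff ℝ 1 (areaPotential κ) := by
  rw [contDiff_one_iff_fderiv]
  refine ⟨fun p => (hasStrictFDerivAt_areaPotential hκ p).hasFDerivAt.differentiableAt, ?_⟩
  rw [continuous_clm_apply]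
  rintro ⟨a, b⟩
  simp_rw [fun p => (hasStrictFDerivAt_areaPotential hκ p).hasFDerivAt.fderiv]
  simp only [ContinuousLinearMap.coprod_apply, ContinuousLinearMap.toSpanSingleton_apply,
    smul_eq_mul]
  have hc := hκ.continuous
  have hc' : Continuous (fun z => fderiv ℝ κ z (1, 0)) :=
    (hκ.continuous_fderiv one_ne_zero).clm_apply continuous_const
  have h2 : Continuous fun v : ℝ × ℝ => ∫ s in (0 : ℝ)..v.2, fderiv ℝ κ (v.1, s) (1, 0) := by
    apply intervalIntegral.continuous_parametric_intervalIntegral_of_continuous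
      (f := fun (v : ℝ × ℝ) s => fderiv ℝ κ (v.1, s) (1, 0))
    · exact hc'.comp (by fun_prop : Continuous fun w : (ℝ × ℝ) × ℝ => (w.1.1, w.2))
    · fun_prop
  fun_prop

lemma fderiv_areaPotential_snd {κ : ℝ × ℝ → ℝ} (hκ : ContDiff ℝ 1 κ) (p : ℝ × ℝ) :
    fderiv ℝ (areaPotential κ) p (0, 1) = -κ p := by
  rw [(hasStrictFDerivAt_areaPotential hκ p).hasFDerivAt.fderiv]
  simp

/-- Uniform first order expansion of a `C¹` function on a convex compact set. -/
lemma exists_uniform_fderiv_expansion {E F : Type*} [NormedAddCommGroup E] [NormedSpace ℝ E]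
    [NormedAddCommGroup F] [NormedSpace ℝ F] {f : E → F} {U C : Set E} (hU : IsOpen U)
    (hf : ContDiffOn ℝ 1 f U) (hC : IsCompact C) (hconv : Convex ℝ C) (hCU : C ⊆ U)
    {η : ℝ} (hη : 0 < η) :
    ∃ δ > 0, ∀ x ∈ C, ∀ y ∈ C, ‖y - x‖ < δ →
      ‖f y - f x - fderiv ℝ f x (y - x)‖ ≤ η * ‖y - x‖ := by
  have hcont : ContinuousOn (fderiv ℝ f) C :=
    (hf.continuousOn_fderiv_of_isOpen hU le_rfl).mono hCU
  have huc := hC.uniformContinuousOn_of_continuous hcont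
  rw [Metric.uniformContinuousOn_iff] at huc
  obtain ⟨δ, hδ, h⟩ := huc η hη
  refine ⟨δ, hδ, fun x hx y hy hxy => ?_⟩
  have hseg : segment ℝ x y ⊆ C := hconv.segment_subset hx hy
  refine (convex_segment x y).norm_image_sub_le_of_norm_fderiv_le' (𝕜 := ℝ) (f := f)
    (φ := fderiv ℝ f x) (fun w hw => ?_) (fun w hw => ?_)
    (left_mem_segment ..) (right_mem_segment ..)
  · exact (hf.contDiffAt (hU.mem_nhds (hCU (hseg hw)))).differentiableAt one_ne_zero
  · rw [← dist_eq_norm]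
    refine (h w (hseg hw) x hx ?_).le
    rw [dist_eq_norm]
    refine lt_of_le_of_lt ?_ hxy
    rw [segment_eq_image'] at hw
    obtain ⟨t, ht, rfl⟩ := hw
    rw [add_sub_cancel_left, norm_smul, Real.norm_of_nonneg ht.1]
    exact mul_le_of_le_one_left (norm_nonneg _) ht.2

section PeriodicPrimitive

variable {E : Type*} [NormedAddCommGroup E] [NormedSpace ℝ E]

/-- The zero-mean primitive of a `2π`-periodic function with zero mean. -/
def meanPrim (f : ℝ → E) (t : ℝ) : E :=
  (∫ s in (0 : ℝ)..t, f s) - (1 / (2 * π)) • ∫ r in (0 : ℝ)..(2 * π), ∫ s in (0 : ℝ)..r, f s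

lemma hasDerivAt_meanPrim [CompleteSpace E] {f : ℝ → E} (hf : Continuous f) (t : ℝ) :
    HasDerivAt (meanPrim f) (f t) t :=
  (intervalIntegral.integral_hasDerivAt_right (hf.intervalIntegrable _ _)
    (hf.stronglyMeasurableAtFilter _ _) hf.continuousAt).sub_const _

lemma continuous_meanPrim [CompleteSpace E] {f : ℝ → E} (hf : Continuous f) : Continuous (meanPrim f) :=
  continuous_iff_continuousAt.2 fun t => (hasDerivAt_meanPrim hf t).continuousAt

lemma periodic_integral_of_integral_eq_zero {f : ℝ → E} (hf : Continuous f)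
    (hp : Function.Periodic f (2 * π)) (h0 : ∫ s in (0 : ℝ)..(2 * π), f s = 0) :
    Function.Periodic (fun t => ∫ s in (0 : ℝ)..t, f s) (2 * π) := by
  intro t
  have h1 := intervalIntegral.integral_add_adjacent_intervals
    (hf.intervalIntegrable (μ := volume) 0 t) (hf.intervalIntegrable (μ := volume) t (t + 2 * π))
  have h2 := hp.intervalIntegral_add_eq t 0
  rw [zero_add, h0] at h2
  simp only
  rw [← h1, h2, add_zero]

lemma periodic_meanPrim {f : ℝ → E} (hf : Continuous f)
    (hp : Function.Periodic f (2 * π)) (h0 : ∫ s in (0 : ℝ)..(2 * π), f s = 0) :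
    Function.Periodic (meanPrim f) (2 * π) := fun t => by
  have := periodic_integral_of_integral_eq_zero hf hp h0 t
  simp only [meanPrim] at this ⊢
  rw [this]

lemma integral_meanPrim [CompleteSpace E] {f : ℝ → E} (hf : Continuous f) :
    ∫ t in (0 : ℝ)..(2 * π), meanPrim f t = 0 := by
  have hc : Continuous fun t => ∫ s in (0 : ℝ)..t, f s :=
    intervalIntegral.continuous_primitive (fun _ _ => hf.intervalIntegrable _ _) 0
  unfold meanPrim
  rw [intervalIntegral.integral_sub (hc.intervalIntegrable _ _) (by simp)]
  rw [intervalIntegral.integral_const, smul_smul, sub_zero,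
    mul_one_div_cancel (by positivity), one_smul, sub_self]

lemma norm_meanPrim_le {f : ℝ → E} (hf : Continuous f)
    (hp : Function.Periodic f (2 * π)) (h0 : ∫ s in (0 : ℝ)..(2 * π), f s = 0) {C : ℝ}
    (hC : ∀ t, ‖f t‖ ≤ C) (t : ℝ) : ‖meanPrim f t‖ ≤ 4 * π * C := by
  have hC0 : 0 ≤ C := (norm_nonneg _).trans (hC 0)
  have hb : ∀ t, ‖∫ s in (0 : ℝ)..t, f s‖ ≤ 2 * π * C := by
    intro t
    obtain ⟨y, hy, hty⟩ := (periodic_integral_of_integral_eq_zero hf hp h0).exists_mem_Ico₀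
      (by positivity) t
    rw [hty]
    refine (intervalIntegral.norm_integral_le_of_norm_le_const (fun s _ => hC s)).trans ?_
    rw [sub_zero, abs_of_nonneg hy.1, mul_comm]
    exact mul_le_mul_of_nonneg_right hy.2.le hC0
  have hm : ‖(1 / (2 * π)) • ∫ r in (0 : ℝ)..(2 * π), ∫ s in (0 : ℝ)..r, f s‖ ≤ 2 * π * C := by
    have h := intervalIntegral.norm_integral_le_of_norm_le_const
      (a := 0) (b := 2 * π) (fun r _ => hb r)
    rw [sub_zero, abs_of_nonneg (by positivity : 0 ≤ 2 * π)] at h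
    rw [norm_smul, Real.norm_of_nonneg (by positivity)]
    calc 1 / (2 * π) * _ ≤ 1 / (2 * π) * (2 * π * C * (2 * π)) := by gcongr
      _ = 2 * π * C := by field_simp
  calc ‖meanPrim f t‖ ≤ 2 * π * C + 2 * π * C := (norm_sub_le _ _).trans (add_le_add (hb t) hm)
    _ = 4 * π * C := by ring

lemma meanPrim_sub {f g : ℝ → E} (hf : Continuous f) (hg : Continuous g) (t : ℝ) :
    meanPrim f t - meanPrim g t = meanPrim (fun s => f s - g s) t := by
  have hint : ∀ r, ∫ s in (0 : ℝ)..r, (f s - g s)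
      = (∫ s in (0 : ℝ)..r, f s) - ∫ s in (0 : ℝ)..r, g s := fun r =>
    intervalIntegral.integral_sub (hf.intervalIntegrable _ _) (hg.intervalIntegrable _ _)
  have hcf : Continuous fun t => ∫ s in (0 : ℝ)..t, f s :=
    intervalIntegral.continuous_primitive (fun _ _ => hf.intervalIntegrable _ _) 0
  have hcg : Continuous fun t => ∫ s in (0 : ℝ)..t, g s :=
    intervalIntegral.continuous_primitive (fun _ _ => hg.intervalIntegrable _ _) 0
  simp only [meanPrim, hint]
  rw [intervalIntegral.integral_sub (hcf.intervalIntegrable _ _) (hcg.intervalIntegrable _ _),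
    smul_sub]
  abel

/-- For a bounded and Lipschitz operator `N` on periodic functions with values in zero-mean
functions, and small `ε`, the equation `q' = ε N(q)` has a periodic solution with prescribed mean
`z`, depending in a Lipschitz way on `z`. -/
theorem exists_periodic_family [CompleteSpace E] (N : (ℝ → E) → ℝ → E) (C : ℝ)
    (hcont : ∀ q, Continuous q → Function.Periodic q (2 * π) → Continuous (N q))
    (hper : ∀ q, Continuous q → Function.Periodic q (2 * π) → Function.Periodic (N q) (2 * π))
    (hint : ∀ q, Continuous q → Function.Periodic q (2 * π) →
      ∫ t in (0 : ℝ)..(2 * π), N q t = 0)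
    (hbd : ∀ q, Continuous q → Function.Periodic q (2 * π) → ∀ t, ‖N q t‖ ≤ C)
    (hlip : ∀ q q', Continuous q → Function.Periodic q (2 * π) → Continuous q' →
      Function.Periodic q' (2 * π) → ∀ d, (∀ t, ‖q t - q' t‖ ≤ d) →
      ∀ t, ‖N q t - N q' t‖ ≤ C * d)
    (ε : ℝ) (hε : |ε| * (8 * π * C) ≤ 1) :
    ∃ q : E → ℝ → E, (∀ z, Continuous (q z)) ∧ (∀ z, Function.Periodic (q z) (2 * π)) ∧
      (∀ z t, HasDerivAt (q z) (ε • N (q z) t) t) ∧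
      (∀ z, ∫ t in (0 : ℝ)..(2 * π), q z t = (2 * π) • z) ∧
      (∀ z t, ‖q z t - z‖ ≤ 4 * π * C * |ε|) ∧
      (∀ z z' t, ‖q z t - q z' t‖ ≤ 2 * ‖z - z'‖) := by
  have hC0 : 0 ≤ C := (norm_nonneg _).trans
    (hbd (fun _ => 0) continuous_const (fun _ => rfl) 0)
  let S : Set (BoundedContinuousFunction ℝ E) := {q | Function.Periodic q (2 * π)}
  have hSclosed : IsClosed S := by
    have : S = ⋂ t : ℝ, {q : BoundedContinuousFunction ℝ E | q (t + 2 * π) = q t} := by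
      ext q; simp [S, Function.Periodic]
    rw [this]
    exact isClosed_iInter fun t => isClosed_eq
      (continuous_eval_const (t + 2 * π)) (continuous_eval_const t)
  have : CompleteSpace S := hSclosed.completeSpace_coe
  have : Nonempty S := ⟨⟨0, fun _ => rfl⟩⟩
  have hmb : ∀ q : S, ∀ t, ‖meanPrim (N q) t‖ ≤ 4 * π * C := fun q t =>
    norm_meanPrim_le (hcont _ q.1.continuous q.2) (hper _ q.1.continuous q.2)
      (hint _ q.1.continuous q.2) (hbd _ q.1.continuous q.2) t
  let Φ : E → S → S := fun z q =>
    ⟨BoundedContinuousFunction.ofNormedAddCommGroup (fun t => z + ε • meanPrim (N q) t)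
      (continuous_const.add ((continuous_meanPrim (hcont _ q.1.continuous q.2)).const_smul ε))
      (‖z‖ + |ε| * (4 * π * C)) (fun t => by
        refine (norm_add_le _ _).trans ?_
        rw [norm_smul, Real.norm_eq_abs]
        gcongr
        exact hmb q t), fun t => by
        have := periodic_meanPrim (hcont _ q.1.continuous q.2) (hper _ q.1.continuous q.2)
          (hint _ q.1.continuous q.2) t
        simp [this]⟩
  have hΦ : ∀ z q t, (Φ z q).1 t = z + ε • meanPrim (N q) t := fun _ _ _ => rfl
  have hdiff : ∀ q q' : S, ∀ d, (∀ t, ‖q.1 t - q'.1 t‖ ≤ d) → ∀ t,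
      ‖ε • meanPrim (N q) t - ε • meanPrim (N q') t‖ ≤ d / 2 := by
    intro q q' d hd t
    have hd0 : 0 ≤ d := (norm_nonneg _).trans (hd 0)
    have c1 := hcont _ q.1.continuous q.2
    have c2 := hcont _ q'.1.continuous q'.2
    have h : ‖meanPrim (fun s => N q s - N q' s) t‖ ≤ 4 * π * (C * d) := by
      refine norm_meanPrim_le (c1.sub c2) ?_ ?_
        (hlip _ _ q.1.continuous q.2 q'.1.continuous q'.2 d hd) t
      · exact (hper _ q.1.continuous q.2).sub (hper _ q'.1.continuous q'.2)
      · change ∫ s in (0 : ℝ)..(2 * π), (N q s - N q' s) = 0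
        rw [intervalIntegral.integral_sub (c1.intervalIntegrable _ _) (c2.intervalIntegrable _ _),
          hint _ q.1.continuous q.2, hint _ q'.1.continuous q'.2, sub_zero]
    rw [← smul_sub, meanPrim_sub c1 c2, norm_smul, Real.norm_eq_abs]
    calc |ε| * _ ≤ |ε| * (4 * π * (C * d)) := by gcongr
      _ = (|ε| * (8 * π * C)) * (d / 2) := by ring
      _ ≤ 1 * (d / 2) := by gcongr
      _ = d / 2 := one_mul _
  have hcontr : ∀ z, ContractingWith (1 / 2) (Φ z) := by
    intro z
    refine ⟨by rw [one_div]; exact NNReal.inv_lt_one_iff (by norm_num) |>.2 (by norm_num),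
      LipschitzWith.of_dist_le_mul fun q q' => ?_⟩
    rw [Subtype.dist_eq, BoundedContinuousFunction.dist_le (by positivity)]
    intro t
    rw [dist_eq_norm, hΦ, hΦ, add_sub_add_left_eq_sub]
    refine (hdiff q q' (dist q q') (fun t => ?_) t).trans (le_of_eq ?_)
    · rw [← dist_eq_norm]; exact BoundedContinuousFunction.dist_coe_le_dist t
    · push_cast; ring
  let q : E → S := fun z => ContractingWith.fixedPoint (Φ z) (hcontr z)
  have hq : ∀ z t, (q z).1 t = z + ε • meanPrim (N (q z)) t := by
    intro z t
    have : Φ z (q z) = q z := (hcontr z).fixedPoint_isFixedPt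
    conv_lhs => rw [← this]
    rfl
  have hcq : ∀ z, Continuous (N (q z)) := fun z => hcont _ (q z).1.continuous (q z).2
  refine ⟨fun z => (q z).1, fun z => (q z).1.continuous, fun z => (q z).2, fun z t => ?_,
    fun z => ?_, fun z t => ?_, fun z z' t => ?_⟩
  · have h1 := ((hasDerivAt_meanPrim (hcq z) t).const_smul ε).const_add z
    have h2 : (fun t => (q z).1 t) = fun t => z + ε • meanPrim (N (q z)) t := funext (hq z)
    change HasDerivAt (fun t => (q z).1 t) _ t
    rw [h2]
    exact h1
  · simp_rw [hq]
    have hc : Continuous fun t => ε • meanPrim (N (q z)) t :=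
      (continuous_meanPrim (hcq z)).const_smul ε
    rw [intervalIntegral.integral_add intervalIntegrable_const (hc.intervalIntegrable _ _),
      intervalIntegral.integral_smul, integral_meanPrim (hcq z)]
    simp
  · simp only
    rw [hq, add_sub_cancel_left, norm_smul, Real.norm_eq_abs, mul_comm]
    gcongr
    exact hmb (q z) t
  · have hb : dist (q z) (q z') ≤ 2 * ‖z - z'‖ := by
      have h : dist (q z) (q z') ≤ ‖z - z'‖ + dist (q z) (q z') / 2 := by
        conv_lhs => rw [Subtype.dist_eq]
        rw [BoundedContinuousFunction.dist_le (by positivity)]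
        intro t
        rw [dist_eq_norm, hq, hq, add_sub_add_comm]
        refine (norm_add_le _ _).trans (add_le_add le_rfl (hdiff _ _ _ (fun t => ?_) t))
        rw [← dist_eq_norm]; exact BoundedContinuousFunction.dist_coe_le_dist t
      linarith
    refine le_trans ?_ hb
    rw [← dist_eq_norm]; exact BoundedContinuousFunction.dist_coe_le_dist t

end PeriodicPrimitive

/-- The point with tangent angle `θ` on the circle of hyperbolic center `a`
(for `R = R_k`). -/
def circPt (k R θ : ℝ) (a : ℝ × ℝ) : ℝ × ℝ := (a.1 + R * a.2 * sin θ, R * a.2 * (k - cos θ))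

/-- The Lagrangian, at `(θ, q, q')`, of the action functional whose extremals are the curves of
prescribed curvature, parametrized by the tangent angle. -/
def lagr (k R α : ℝ) (κ : ℝ × ℝ → ℝ) (x : ℝ × (ℝ × ℝ) × (ℝ × ℝ)) : ℝ :=
  α * x.2.2.1 / (R * x.2.1.2) + areaPotential κ (circPt k R x.1 x.2.1)
    * (x.2.2.1 + R * x.2.2.2 * sin x.1 + R * x.2.1.2 * cos x.1)

/-- The Euler–Lagrange form of `lagr`, applied to the variation `w`. -/
def eulerLagr (k R α : ℝ) (κ : ℝ × ℝ → ℝ) (θ : ℝ) (a b w : ℝ × ℝ) : ℝ :=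
  R * ((w.1 * b.2 - w.2 * b.1) * (α / (R * a.2) ^ 2 + κ (circPt k R θ a) * (k - cos θ))
    + κ (circPt k R θ a) * a.2 * (sin θ * w.1 + R * (1 - k * cos θ) * w.2))

lemma contDiffOn_lagr {k R α : ℝ} (hR : 0 < R) {κ : ℝ × ℝ → ℝ} (hκ : ContDiff ℝ 1 κ) :
    ContDiffOn ℝ 1 (lagr k R α κ) {x | 0 < x.2.1.2} := by
  have hQ := contDiff_areaPotential hκ
  have hP : ContDiff ℝ 1 fun x : ℝ × (ℝ × ℝ) × (ℝ × ℝ) => circPt k R x.1 x.2.1 := by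
    unfold circPt; fun_prop
  have hQP := hQ.comp hP
  unfold lagr
  refine ContDiffOn.add (ContDiffOn.div (by fun_prop) (by fun_prop) fun x hx => ?_)
    (ContDiff.contDiffOn ?_)
  · exact (mul_pos hR hx).ne'
  · exact hQP.mul (by fun_prop)

lemma hasDerivAt_areaPotential_comp {κ : ℝ × ℝ → ℝ} (hκ : ContDiff ℝ 1 κ) {p : ℝ → ℝ × ℝ}
    {p' : ℝ × ℝ} {t : ℝ} (hp : HasDerivAt p p' t) :
    HasDerivAt (fun s => areaPotential κ (p s))
      (p'.1 * fderiv ℝ (areaPotential κ) (p t) (1, 0) - p'.2 * κ (p t)) t := by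
  have h := ((contDiff_areaPotential hκ).differentiable one_ne_zero (p t)).hasFDerivAt.comp_hasDerivAt
    t hp
  refine h.congr_deriv ?_
  have : p' = p'.1 • ((1 : ℝ), (0 : ℝ)) + p'.2 • ((0 : ℝ), (1 : ℝ)) := by ext <;> simp
  conv_lhs => rw [this]
  rw [map_add, map_smul, map_smul, fderiv_areaPotential_snd hκ]
  simp only [smul_eq_mul]
  ring

lemma HasDerivAt.fst' {p : ℝ → ℝ × ℝ} {p' : ℝ × ℝ} {t : ℝ} (hp : HasDerivAt p p' t) :
    HasDerivAt (fun s => (p s).1) p'.1 t :=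
  (hasFDerivAt_fst (𝕜 := ℝ) (p := p t)).comp_hasDerivAt t hp

lemma HasDerivAt.snd' {p : ℝ → ℝ × ℝ} {p' : ℝ × ℝ} {t : ℝ} (hp : HasDerivAt p p' t) :
    HasDerivAt (fun s => (p s).2) p'.2 t :=
  (hasFDerivAt_snd (𝕜 := ℝ) (p := p t)).comp_hasDerivAt t hp

lemma hasDerivAt_circPt {k R t : ℝ} {q : ℝ → ℝ × ℝ} {b : ℝ × ℝ} {θ : ℝ → ℝ} {θ' : ℝ}
    (hq : HasDerivAt q b t) (hθ : HasDerivAt θ θ' t) :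
    HasDerivAt (fun s => circPt k R (θ s) (q s))
      (b.1 + R * b.2 * sin (θ t) + R * (q t).2 * cos (θ t) * θ',
        R * b.2 * (k - cos (θ t)) + R * (q t).2 * sin (θ t) * θ') t := by
  unfold circPt
  refine HasDerivAt.prodMk ?_ ?_
  · refine (hq.fst'.add ((hq.snd'.const_mul R).mul hθ.sin)).congr_deriv (by ring)
  · refine ((hq.snd'.const_mul R).mul (hθ.cos.const_sub k)).congr_deriv (by ring)

lemma fderiv_lagr_apply {k R α : ℝ} (hR : 0 < R) {κ : ℝ × ℝ → ℝ} (hκ : ContDiff ℝ 1 κ)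
    (θ : ℝ) {a b w w' : ℝ × ℝ} (ha : 0 < a.2) :
    fderiv ℝ (lagr k R α κ) (θ, a, b) (0, w, w') =
      α * w'.1 / (R * a.2) - α * b.1 * w.2 / (R * a.2 ^ 2)
        + ((w.1 + R * w.2 * sin θ) * fderiv ℝ (areaPotential κ) (circPt k R θ a) (1, 0)
            - R * w.2 * (k - cos θ) * κ (circPt k R θ a))
          * (b.1 + R * b.2 * sin θ + R * a.2 * cos θ)
        + areaPotential κ (circPt k R θ a)
          * (w'.1 + R * w'.2 * sin θ + R * w.2 * cos θ) := by
  have hopen : IsOpen {x : ℝ × (ℝ × ℝ) × (ℝ × ℝ) | 0 < x.2.1.2} :=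
    isOpen_lt continuous_const (by fun_prop)
  have hdiff : DifferentiableAt ℝ (lagr k R α κ) (θ, a, b) :=
    ((contDiffOn_lagr hR hκ).contDiffAt (hopen.mem_nhds ha)).differentiableAt one_ne_zero
  have ha' : HasDerivAt (fun s : ℝ => a + s • w) w 0 := by
    simpa using ((hasDerivAt_id (0 : ℝ)).smul_const w).const_add a
  have hb' : HasDerivAt (fun s : ℝ => b + s • w') w' 0 := by
    simpa using ((hasDerivAt_id (0 : ℝ)).smul_const w').const_add b
  have hline : HasDerivAt (fun s : ℝ => (θ, a + s • w, b + s • w')) (0, w, w') 0 :=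
    (hasDerivAt_const (0 : ℝ) θ).prodMk (ha'.prodMk hb')
  have h1 : HasDerivAt (fun s : ℝ => lagr k R α κ (θ, a + s • w, b + s • w'))
      (fderiv ℝ (lagr k R α κ) (θ, a, b) (0, w, w')) 0 := by
    have h0 : HasFDerivAt (lagr k R α κ) (fderiv ℝ (lagr k R α κ) (θ, a, b))
        (θ, a + (0 : ℝ) • w, b + (0 : ℝ) • w') := by simpa using hdiff.hasFDerivAt
    exact h0.comp_hasDerivAt (0 : ℝ) hline
  refine h1.unique ?_
  have hp := hasDerivAt_circPt (k := k) (R := R) ha' (hasDerivAt_const (0 : ℝ) θ)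
  have hQ := hasDerivAt_areaPotential_comp hκ hp
  have hden : HasDerivAt (fun s : ℝ => R * (a + s • w).2) (R * w.2) 0 := ha'.snd'.const_mul R
  have hne : R * (a + (0 : ℝ) • w).2 ≠ 0 := by simpa using ⟨hR.ne', ha.ne'⟩
  have hX := (hb'.fst'.add ((hb'.snd'.const_mul R).mul_const (sin θ))).add
    ((ha'.snd'.const_mul R).mul_const (cos θ))
  have := ((hb'.fst'.const_mul α).div hden hne).add (hQ.mul hX)
  refine this.congr_deriv ?_
  simp only [zero_smul, add_zero, mul_zero, Pi.add_apply]
  have ha2 := ha.ne'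
  have hR2 := hR.ne'
  field_simp
  ring

lemma hasDerivAt_lagr_boundary {k R α : ℝ} (hR : 0 < R) {κ : ℝ × ℝ → ℝ} (hκ : ContDiff ℝ 1 κ)
    {t : ℝ} {q w : ℝ → ℝ × ℝ} {b w' : ℝ × ℝ} (hq : HasDerivAt q b t) (hw : HasDerivAt w w' t)
    (hpos : 0 < (q t).2) :
    HasDerivAt (fun s => α * (w s).1 / (R * (q s).2)
        + areaPotential κ (circPt k R s (q s)) * ((w s).1 + R * (w s).2 * sin s))
      (fderiv ℝ (lagr k R α κ) (t, q t, b) (0, w t, w') - eulerLagr k R α κ t (q t) b (w t)) t := by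
  have hp := hasDerivAt_circPt (k := k) (R := R) hq (hasDerivAt_id t)
  have hQ := hasDerivAt_areaPotential_comp hκ hp
  have hne : R * (q t).2 ≠ 0 := (mul_pos hR hpos).ne'
  have := ((hw.fst'.const_mul α).div (hq.snd'.const_mul R) hne).add
    (hQ.mul (hw.fst'.add ((hw.snd'.const_mul R).mul (hasDerivAt_sin t))))
  refine this.congr_deriv ?_
  rw [fderiv_lagr_apply hR hκ t hpos]
  simp only [id, eulerLagr]
  have ha2 := hpos.ne'
  have hR2 := hR.ne'
  have hs : sin t ^ 2 = 1 - cos t ^ 2 := by rw [← sin_sq_add_cos_sq t]; ring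
  simp only [Pi.add_apply, Pi.mul_apply]
  field_simp
  ring_nf
  rw [hs]
  ring

/-- First variation of the action along periodic variations. -/
lemma integral_fderiv_lagr {k R α : ℝ} (hR : 0 < R) {κ : ℝ × ℝ → ℝ} (hκ : ContDiff ℝ 1 κ)
    {q w b w' : ℝ → ℝ × ℝ} (hq : ∀ t, HasDerivAt q (b t) t) (hw : ∀ t, HasDerivAt w (w' t) t)
    (hb : Continuous b) (hw' : Continuous w') (hpos : ∀ t, 0 < (q t).2)
    (hqp : Function.Periodic q (2 * π)) (hwp : Function.Periodic w (2 * π)) :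
    (Continuous fun t => fderiv ℝ (lagr k R α κ) (t, q t, b t) (0, w t, w' t)) ∧
    ∫ t in (0 : ℝ)..(2 * π), fderiv ℝ (lagr k R α κ) (t, q t, b t) (0, w t, w' t)
      = ∫ t in (0 : ℝ)..(2 * π), eulerLagr k R α κ t (q t) (b t) (w t) := by
  have hqc : Continuous q := continuous_iff_continuousAt.2 fun t => (hq t).continuousAt
  have hwc : Continuous w := continuous_iff_continuousAt.2 fun t => (hw t).continuousAt
  have hopen : IsOpen {x : ℝ × (ℝ × ℝ) × (ℝ × ℝ) | 0 < x.2.1.2} :=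
    isOpen_lt continuous_const (by fun_prop)
  have hcf : Continuous fun t => fderiv ℝ (lagr k R α κ) (t, q t, b t) := by
    have := (contDiffOn_lagr (k := k) (α := α) hR hκ).continuousOn_fderiv_of_isOpen hopen le_rfl
    exact this.comp_continuous (by fun_prop) hpos
  have hc1 : Continuous fun t => fderiv ℝ (lagr k R α κ) (t, q t, b t) (0, w t, w' t) :=
    hcf.clm_apply (by fun_prop)
  have hκc := hκ.continuous
  have hc2 : Continuous fun t => eulerLagr k R α κ t (q t) (b t) (w t) := by
    have hcp : Continuous fun t => κ (circPt k R t (q t)) := by unfold circPt; fun_prop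
    have hd : Continuous fun t => α / (R * (q t).2) ^ 2 :=
      continuous_const.div (by fun_prop) fun t => (pow_pos (mul_pos hR (hpos t)) 2).ne'
    unfold eulerLagr
    refine continuous_const.mul (Continuous.add (Continuous.mul (by fun_prop)
      (hd.add (hcp.mul (by fun_prop)))) ((hcp.mul (by fun_prop)).mul (by fun_prop)))
  refine ⟨hc1, ?_⟩
  have hFTC := intervalIntegral.integral_eq_sub_of_hasDerivAt (a := 0) (b := 2 * π)
    (fun t _ => hasDerivAt_lagr_boundary (k := k) (α := α) hR hκ (hq t) (hw t) (hpos t))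
    ((hc1.sub hc2).intervalIntegrable _ _)
  rw [intervalIntegral.integral_sub (hc1.intervalIntegrable _ _) (hc2.intervalIntegrable _ _)]
    at hFTC
  have hq0 : q (2 * π) = q 0 := by simpa using hqp 0
  have hw0 : w (2 * π) = w 0 := by simpa using hwp 0
  have hc0 : circPt k R (2 * π) (q 0) = circPt k R 0 (q 0) := by simp [circPt]
  rw [hq0, hw0, hc0, sin_two_pi, sin_zero, sub_self] at hFTC
  linarith

/-- Differentiability of the action along a Lipschitz family of periodic curves. -/
theorem hasFDerivAt_action {k R α : ℝ} (hR : 0 < R) {κ : ℝ × ℝ → ℝ} (hκ : ContDiff ℝ 1 κ)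
    {V W : Set (ℝ × ℝ)} (hV : IsOpen V) (hW : IsCompact W) (hWc : Convex ℝ W)
    (hWpos : ∀ a ∈ W, 0 < a.2) {q b : ℝ × ℝ → ℝ → ℝ × ℝ}
    (hq : ∀ z ∈ V, ∀ t, HasDerivAt (q z) (b z t) t) (hb : ∀ z ∈ V, Continuous (b z))
    (hqp : ∀ z ∈ V, Function.Periodic (q z) (2 * π)) (hqW : ∀ z ∈ V, ∀ t, q z t ∈ W)
    {Cb Cl : ℝ} (hbb : ∀ z ∈ V, ∀ t, ‖b z t‖ ≤ Cb)
    (hql : ∀ z ∈ V, ∀ z' ∈ V, ∀ t, ‖q z t - q z' t‖ ≤ Cl * ‖z - z'‖)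
    (hbl : ∀ z ∈ V, ∀ z' ∈ V, ∀ t, ‖b z t - b z' t‖ ≤ Cl * ‖z - z'‖)
    {z₀ : ℝ × ℝ} (hz₀ : z₀ ∈ V) (ℓ : ℝ × ℝ →L[ℝ] ℝ)
    (hℓ : ∀ z ∈ V, ∫ t in (0 : ℝ)..(2 * π),
      eulerLagr k R α κ t (q z₀ t) (b z₀ t) (q z t - q z₀ t) = ℓ (z - z₀)) :
    HasFDerivAt (fun z => ∫ t in (0 : ℝ)..(2 * π), lagr k R α κ (t, q z t, b z t)) ℓ z₀ := by
  have hopen : IsOpen {x : ℝ × (ℝ × ℝ) × (ℝ × ℝ) | 0 < x.2.1.2} :=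
    isOpen_lt continuous_const (by fun_prop)
  set C : Set (ℝ × (ℝ × ℝ) × (ℝ × ℝ)) :=
    Set.Icc 0 (2 * π) ×ˢ (W ×ˢ Metric.closedBall 0 Cb) with hCdef
  have hC : IsCompact C := isCompact_Icc.prod (hW.prod (isCompact_closedBall _ _))
  have hCc : Convex ℝ C := (convex_Icc _ _).prod (hWc.prod (convex_closedBall _ _))
  have hCU : C ⊆ {x | 0 < x.2.1.2} := fun x hx => hWpos _ hx.2.1
  have hmem : ∀ z ∈ V, ∀ t ∈ Set.Icc 0 (2 * π), (t, q z t, b z t) ∈ C := fun z hz t ht =>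
    ⟨ht, hqW z hz t, by simpa using hbb z hz t⟩
  have hqc : ∀ z ∈ V, Continuous (q z) := fun z hz =>
    continuous_iff_continuousAt.2 fun t => (hq z hz t).continuousAt
  have hLc : ∀ z ∈ V, Continuous fun t => lagr k R α κ (t, q z t, b z t) := fun z hz =>
    (contDiffOn_lagr hR hκ).continuousOn.comp_continuous
      (by have := hqc z hz; have := hb z hz; fun_prop) fun t => hWpos _ (hqW z hz t)
  rw [hasFDerivAt_iff_isLittleO, Asymptotics.isLittleO_iff]
  intro c hc
  set η := c / (2 * π * (|Cl| + 1)) with hη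
  have hηpos : 0 < η := by positivity
  obtain ⟨δ, hδ, hexp⟩ := exists_uniform_fderiv_expansion hopen
    (contDiffOn_lagr (k := k) (α := α) hR hκ) hC hCc hCU hηpos
  have hnear : ∀ᶠ z in 𝓝 z₀, ‖z - z₀‖ < δ / (|Cl| + 1) := by
    have : Metric.ball z₀ (δ / (|Cl| + 1)) ∈ 𝓝 z₀ := Metric.ball_mem_nhds _ (by positivity)
    filter_upwards [this] with z hz
    rwa [mem_ball_iff_norm] at hz
  filter_upwards [hnear, hV.mem_nhds hz₀] with z hzδ hz
  have hvar := integral_fderiv_lagr (k := k) (α := α) hR hκ (hq z₀ hz₀)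
    (fun t => (hq z hz t).sub (hq z₀ hz₀ t)) (hb z₀ hz₀) ((hb z hz).sub (hb z₀ hz₀))
    (fun t => hWpos _ (hqW z₀ hz₀ t)) (hqp z₀ hz₀) ((hqp z hz).sub (hqp z₀ hz₀))
  simp only [Pi.sub_apply] at hvar
  have hdc : Continuous fun t => lagr k R α κ (t, q z t, b z t)
      - lagr k R α κ (t, q z₀ t, b z₀ t) := (hLc z hz).sub (hLc z₀ hz₀)
  rw [← hℓ z hz, ← hvar.2, ← intervalIntegral.integral_sub ((hLc z hz).intervalIntegrable _ _)
    ((hLc z₀ hz₀).intervalIntegrable _ _), ← intervalIntegral.integral_sub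
    (hdc.intervalIntegrable _ _) (hvar.1.intervalIntegrable _ _)]
  have hbound : ∀ t ∈ Set.uIoc (0 : ℝ) (2 * π),
      ‖lagr k R α κ (t, q z t, b z t) - lagr k R α κ (t, q z₀ t, b z₀ t)
        - fderiv ℝ (lagr k R α κ) (t, q z₀ t, b z₀ t) (0, q z t - q z₀ t, b z t - b z₀ t)‖
        ≤ η * ((|Cl| + 1) * ‖z - z₀‖) := by
    intro t ht
    rw [Set.uIoc_of_le (by positivity)] at ht
    have ht' : t ∈ Set.Icc 0 (2 * π) := ⟨ht.1.le, ht.2⟩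
    have hsub : ((t, q z t, b z t) : ℝ × (ℝ × ℝ) × (ℝ × ℝ)) - (t, q z₀ t, b z₀ t)
        = (0, q z t - q z₀ t, b z t - b z₀ t) := by simp
    have hle : Cl * ‖z - z₀‖ ≤ (|Cl| + 1) * ‖z - z₀‖ := by
      gcongr; linarith [le_abs_self Cl]
    have hnorm : ‖((0, q z t - q z₀ t, b z t - b z₀ t) : ℝ × (ℝ × ℝ) × (ℝ × ℝ))‖
        ≤ (|Cl| + 1) * ‖z - z₀‖ := by
      rw [Prod.norm_def, Prod.norm_def]
      refine max_le ?_ (max_le ((hql z hz z₀ hz₀ t).trans hle) ((hbl z hz z₀ hz₀ t).trans hle))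
      simp only [norm_zero]; positivity
    have hlt : (|Cl| + 1) * ‖z - z₀‖ < δ := by
      rw [lt_div_iff₀ (by positivity)] at hzδ; linarith
    have := hexp _ (hmem z₀ hz₀ t ht') _ (hmem z hz t ht') (by rw [hsub]; exact hnorm.trans_lt hlt)
    rw [hsub] at this
    exact this.trans (by gcongr)
  refine (intervalIntegral.norm_integral_le_of_norm_le_const hbound).trans (le_of_eq ?_)
  rw [sub_zero, abs_of_nonneg (by positivity : (0 : ℝ) ≤ 2 * π), hη]
  field_simp

/-- The forcing term of the equation for the moving center, before normalization. -/
def forcing (k R : ℝ) (κ : ℝ × ℝ → ℝ) (θ : ℝ) (a : ℝ × ℝ) : ℝ × ℝ :=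
  (-(κ (circPt k R θ a) * a.2)) • (R * (k * cos θ - 1), sin θ)

/-- The normalizing factor of the equation for the moving center. -/
def normFactor (k R : ℝ) (κ : ℝ × ℝ → ℝ) (ε θ : ℝ) (a : ℝ × ℝ) : ℝ :=
  (R * a.2) ^ 2 / (1 + ε * (κ (circPt k R θ a) * (k - cos θ) * (R * a.2) ^ 2))

lemma circPt_add_two_pi (k R θ : ℝ) (a : ℝ × ℝ) : circPt k R (θ + 2 * π) a = circPt k R θ a := by
  simp [circPt]

lemma forcing_add_two_pi (k R : ℝ) (κ : ℝ × ℝ → ℝ) (θ : ℝ) (a : ℝ × ℝ) :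
    forcing k R κ (θ + 2 * π) a = forcing k R κ θ a := by
  simp [forcing, circPt_add_two_pi]

lemma normFactor_add_two_pi (k R : ℝ) (κ : ℝ × ℝ → ℝ) (ε θ : ℝ) (a : ℝ × ℝ) :
    normFactor k R κ ε (θ + 2 * π) a = normFactor k R κ ε θ a := by
  simp [normFactor, circPt_add_two_pi]

lemma contDiff_forcing {k R : ℝ} {κ : ℝ × ℝ → ℝ} (hκ : ContDiff ℝ 1 κ) :
    ContDiff ℝ 1 fun x : ℝ × (ℝ × ℝ) => forcing k R κ x.1 x.2 := by
  have hP : ContDiff ℝ 1 fun x : ℝ × (ℝ × ℝ) => circPt k R x.1 x.2 := by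
    unfold circPt; fun_prop
  have := hκ.comp hP
  unfold forcing
  exact ((this.mul (by fun_prop)).neg).smul (by fun_prop)

lemma exists_normFactor_bounds {k R : ℝ} (hR : 0 < R) {κ : ℝ × ℝ → ℝ} (hκ : ContDiff ℝ 1 κ)
    {W : Set (ℝ × ℝ)} (hW : IsCompact W) (hWc : Convex ℝ W) {m : ℝ} (hm : 0 < m)
    (hWm : ∀ a ∈ W, m ≤ a.2) :
    ∃ ε₁ > 0, ∃ c > 0, ∃ C > 0,
      (∀ ε, |ε| ≤ ε₁ → ∀ θ, ∀ a ∈ W,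
        1 / 2 ≤ 1 + ε * (κ (circPt k R θ a) * (k - cos θ) * (R * a.2) ^ 2) ∧
        c ≤ normFactor k R κ ε θ a ∧ normFactor k R κ ε θ a ≤ C ∧
        ‖normFactor k R κ ε θ a • forcing k R κ θ a‖ ≤ C) ∧
      (∀ ε ε', |ε| ≤ ε₁ → |ε'| ≤ ε₁ → ∀ θ, ∀ a ∈ W, ∀ a' ∈ W,
        |normFactor k R κ ε θ a - normFactor k R κ ε' θ a'| ≤ C * (|ε - ε'| + ‖a - a'‖) ∧
        ‖normFactor k R κ ε θ a • forcing k R κ θ a - normFactor k R κ ε' θ a' • forcing k R κ θ a'‖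
          ≤ C * (|ε - ε'| + ‖a - a'‖)) := by
  have hPc : ContDiff ℝ 1 fun x : ℝ × (ℝ × ℝ) => circPt k R x.1 x.2 := by
    unfold circPt; fun_prop
  have hκP := hκ.comp hPc
  have hgc : ContDiff ℝ 1 fun x : ℝ × (ℝ × ℝ) =>
      κ (circPt k R x.1 x.2) * (k - cos x.1) * (R * x.2.2) ^ 2 :=
    (hκP.mul (by fun_prop)).mul (by fun_prop)
  have hcpt : IsCompact (Set.Icc (0 : ℝ) (2 * π) ×ˢ W) := isCompact_Icc.prod hW
  obtain ⟨B, hB⟩ := hcpt.exists_bound_of_continuousOn hgc.continuous.continuousOn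
  set ε₁ : ℝ := 1 / (2 * (|B| + 1)) with hε₁
  have hε₁pos : 0 < ε₁ := by positivity
  have hden : ∀ ε, |ε| ≤ ε₁ → ∀ θ ∈ Set.Icc (0 : ℝ) (2 * π), ∀ a ∈ W,
      |ε * (κ (circPt k R θ a) * (k - cos θ) * (R * a.2) ^ 2)| ≤ 1 / 2 := by
    intro ε hε θ hθ a ha
    rw [abs_mul]
    have h1 := hB (θ, a) ⟨hθ, ha⟩
    rw [Real.norm_eq_abs] at h1
    have h2 : |κ (circPt k R θ a) * (k - cos θ) * (R * a.2) ^ 2| ≤ |B| + 1 :=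
      h1.trans (by linarith [le_abs_self B])
    calc _ ≤ ε₁ * (|B| + 1) := by gcongr
      _ = 1 / 2 := by rw [hε₁]; field_simp
  set S : Set (ℝ × ℝ × (ℝ × ℝ)) := Set.Icc (-ε₁) ε₁ ×ˢ (Set.Icc (0 : ℝ) (2 * π) ×ˢ W) with hS
  have hScpt : IsCompact S := isCompact_Icc.prod hcpt
  have hSconv : Convex ℝ S := (convex_Icc _ _).prod ((convex_Icc _ _).prod hWc)
  have hpair : ContDiffOn ℝ 1 (fun x : ℝ × ℝ × (ℝ × ℝ) => (normFactor k R κ x.1 x.2.1 x.2.2,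
      normFactor k R κ x.1 x.2.1 x.2.2 • forcing k R κ x.2.1 x.2.2)) S := by
    have hJ : ContDiffOn ℝ 1 (fun x : ℝ × ℝ × (ℝ × ℝ) => normFactor k R κ x.1 x.2.1 x.2.2) S := by
      unfold normFactor
      refine ContDiffOn.div (by fun_prop) ?_ ?_
      · exact (contDiff_const.add (contDiff_fst.mul (hgc.comp contDiff_snd))).contDiffOn
      · rintro ⟨ε, θ, a⟩ ⟨hε, hθ, ha⟩
        have := abs_le.1 (hden ε (abs_le.2 hε) θ hθ a ha)
        have h3 : 0 < 1 + ε * (κ (circPt k R θ a) * (k - cos θ) * (R * a.2) ^ 2) := by linarith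
        exact h3.ne'
    exact hJ.prodMk (hJ.smul ((contDiff_forcing hκ).comp contDiff_snd).contDiffOn)
  obtain ⟨Λ, hΛ⟩ := hpair.exists_lipschitzOnWith one_ne_zero hSconv hScpt
  obtain ⟨B', hB'⟩ := hScpt.exists_bound_of_continuousOn hpair.continuousOn
  have hper : ∀ θ : ℝ, ∃ θ' ∈ Set.Icc (0 : ℝ) (2 * π), ∀ a : ℝ × ℝ,
      circPt k R θ a = circPt k R θ' a ∧ cos θ = cos θ' ∧ sin θ = sin θ' := by
    intro θ
    have hp : Function.Periodic (fun θ => (cos θ, sin θ)) (2 * π) := fun θ => by simp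
    obtain ⟨θ', h1, h2⟩ := hp.exists_mem_Ico₀ (by positivity) θ
    simp only [Prod.mk.injEq] at h2
    exact ⟨θ', ⟨h1.1, h1.2.le⟩, fun a => ⟨by simp [circPt, h2.1, h2.2], h2⟩⟩
  refine ⟨ε₁, hε₁pos, (R * m) ^ 2 / 2, by positivity, max |B'| Λ + 1, by positivity, ?_, ?_⟩
  · intro ε hε θ a ha
    obtain ⟨θ', hθ', h⟩ := hper θ
    obtain ⟨h1, h2, h3⟩ := h a
    have h4 := abs_le.1 (hden ε hε θ' hθ' a ha)
    have hb := hB' (ε, θ', a) ⟨abs_le.1 hε, hθ', ha⟩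
    have e1 : normFactor k R κ ε θ a = normFactor k R κ ε θ' a := by simp [normFactor, h1, h2]
    have e2 : forcing k R κ θ a = forcing k R κ θ' a := by simp [forcing, h1, h2, h3]
    have hB'' : B' ≤ max |B'| Λ + 1 := by
      have := le_max_left |B'| (Λ : ℝ); linarith [le_abs_self B']
    rw [h1, h2, e1, e2]
    refine ⟨by linarith, ?_, ?_, ?_⟩
    · unfold normFactor
      rw [div_le_div_iff₀ (by norm_num) (by linarith)]
      have h5 : (R * m) ^ 2 ≤ (R * a.2) ^ 2 := by
        have := hWm a ha
        gcongr
      nlinarith [sq_nonneg (R * m)]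
    · exact (Real.le_norm_self _).trans ((norm_fst_le _).trans (hb.trans hB''))
    · exact (norm_snd_le _).trans (hb.trans hB'')
  · intro ε ε' hε hε' θ a ha a' ha'
    obtain ⟨θ', hθ', h⟩ := hper θ
    obtain ⟨h1, h2, h3⟩ := h a
    have h1' := (h a').1
    have e1 : normFactor k R κ ε θ a = normFactor k R κ ε θ' a := by simp [normFactor, h1, h2]
    have e2 : forcing k R κ θ a = forcing k R κ θ' a := by simp [forcing, h1, h2, h3]
    have e1' : normFactor k R κ ε' θ a' = normFactor k R κ ε' θ' a' := by
      simp [normFactor, h1', h2]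
    have e2' : forcing k R κ θ a' = forcing k R κ θ' a' := by simp [forcing, h1', h2, h3]
    have hl := hΛ.norm_sub_le (x := (ε, θ', a)) ⟨abs_le.1 hε, hθ', ha⟩ (y := (ε', θ', a'))
      ⟨abs_le.1 hε', hθ', ha'⟩
    have hn : ‖((ε, θ', a) : ℝ × ℝ × (ℝ × ℝ)) - (ε', θ', a')‖ ≤ |ε - ε'| + ‖a - a'‖ := by
      simp only [Prod.mk_sub_mk, sub_self, Prod.norm_mk, norm_zero, Real.norm_eq_abs]
      refine max_le (by linarith [norm_nonneg (a - a')]) (max_le (by positivity) ?_)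
      linarith [abs_nonneg (ε - ε')]
    have hC : (Λ : ℝ) ≤ max |B'| Λ + 1 := by
      have := le_max_right |B'| (Λ : ℝ); linarith
    have hfin : ‖(normFactor k R κ ε θ' a, normFactor k R κ ε θ' a • forcing k R κ θ' a)
        - (normFactor k R κ ε' θ' a', normFactor k R κ ε' θ' a' • forcing k R κ θ' a')‖
        ≤ (max |B'| Λ + 1) * (|ε - ε'| + ‖a - a'‖) :=
      hl.trans (mul_le_mul hC hn (norm_nonneg _) (by positivity))
    rw [e1, e2, e1', e2']
    exact ⟨(norm_fst_le _).trans hfin, (norm_snd_le _).trans hfin⟩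

section Multiplier
variable {E : Type*} [NormedAddCommGroup E] [NormedSpace ℝ E]

/-- The constant vector `μ` making `h + j • μ` of zero mean. -/
def multiplier (j : ℝ → ℝ) (h : ℝ → E) : E :=
  -((∫ t in (0 : ℝ)..(2 * π), j t)⁻¹ • ∫ t in (0 : ℝ)..(2 * π), h t)

lemma le_integral_two_pi {j : ℝ → ℝ} (hj : Continuous j) {c : ℝ} (hc : ∀ t, c ≤ j t) :
    2 * π * c ≤ ∫ t in (0 : ℝ)..(2 * π), j t := by
  have := intervalIntegral.integral_mono_on (a := 0) (b := 2 * π) (μ := volume) (by positivity)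
    (continuous_const (y := c) |>.intervalIntegrable _ _) (hj.intervalIntegrable _ _) (fun t _ => hc t)
  simpa using this

lemma norm_integral_two_pi_le {h : ℝ → E} {C : ℝ} (hC : ∀ t, ‖h t‖ ≤ C) :
    ‖∫ t in (0 : ℝ)..(2 * π), h t‖ ≤ 2 * π * C := by
  have := intervalIntegral.norm_integral_le_of_norm_le_const (a := 0) (b := 2 * π) (f := h)
    (C := C) (fun t _ => hC t)
  rwa [sub_zero, abs_of_nonneg (by positivity), mul_comm C] at this

lemma integral_smul_multiplier {j : ℝ → ℝ} (hj : Continuous j) {c : ℝ} (hc0 : 0 < c)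
    (hc : ∀ t, c ≤ j t) (h : ℝ → E) :
    (∫ t in (0 : ℝ)..(2 * π), j t) • multiplier j h = -∫ t in (0 : ℝ)..(2 * π), h t := by
  have h1 := le_integral_two_pi hj hc
  have h2 : 0 < 2 * π * c := by positivity
  rw [multiplier, smul_neg, smul_inv_smul₀ (h2.trans_le h1).ne']

lemma norm_multiplier_le {j : ℝ → ℝ} (hj : Continuous j) {c C : ℝ} (hc0 : 0 < c)
    (hc : ∀ t, c ≤ j t) {h : ℝ → E} (hC : ∀ t, ‖h t‖ ≤ C) :
    ‖multiplier j h‖ ≤ C / c := by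
  have h1 := le_integral_two_pi hj hc
  have h2 : 0 < 2 * π * c := by positivity
  have h3 := congrArg norm (integral_smul_multiplier hj hc0 hc h)
  rw [norm_smul, norm_neg, Real.norm_of_nonneg (h2.trans_le h1).le] at h3
  have h4 := norm_integral_two_pi_le hC
  rw [le_div_iff₀ hc0]
  have h5 : 2 * π * c * ‖multiplier j h‖ ≤ 2 * π * C :=
    (mul_le_mul_of_nonneg_right h1 (norm_nonneg _)).trans (h3.le.trans h4)
  have h6 : 0 < 2 * π := by positivity
  nlinarith

lemma norm_multiplier_sub_le {j j' : ℝ → ℝ} (hj : Continuous j) (hj' : Continuous j') {c C d : ℝ}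
    (hc0 : 0 < c) (hc : ∀ t, c ≤ j t) (hc' : ∀ t, c ≤ j' t) {h h' : ℝ → E} (hh : Continuous h)
    (hh' : Continuous h') (hC : ∀ t, ‖h' t‖ ≤ C) (hjd : ∀ t, |j t - j' t| ≤ C * d)
    (hhd : ∀ t, ‖h t - h' t‖ ≤ C * d) :
    ‖multiplier j h - multiplier j' h'‖ ≤ (C + C * (C / c)) / c * d := by
  have h1 := le_integral_two_pi hj hc
  have h2 : 0 < 2 * π * c := by positivity
  have e1 := integral_smul_multiplier hj hc0 hc h
  have e2 := integral_smul_multiplier hj' hc0 hc' h'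
  have hI : ‖∫ t in (0 : ℝ)..(2 * π), (h t - h' t)‖ ≤ 2 * π * (C * d) :=
    norm_integral_two_pi_le hhd
  have hJ : ‖∫ t in (0 : ℝ)..(2 * π), (j t - j' t)‖ ≤ 2 * π * (C * d) :=
    norm_integral_two_pi_le hjd
  rw [intervalIntegral.integral_sub (hh.intervalIntegrable _ _) (hh'.intervalIntegrable _ _)] at hI
  rw [intervalIntegral.integral_sub (hj.intervalIntegrable _ _) (hj'.intervalIntegrable _ _)] at hJ
  have hμ := norm_multiplier_le hj' hc0 hc' hC
  have key : (∫ t in (0 : ℝ)..(2 * π), j t) • (multiplier j h - multiplier j' h')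
      = -((∫ t in (0 : ℝ)..(2 * π), h t) - ∫ t in (0 : ℝ)..(2 * π), h' t)
        - ((∫ t in (0 : ℝ)..(2 * π), j t) - ∫ t in (0 : ℝ)..(2 * π), j' t) • multiplier j' h' := by
    rw [smul_sub, e1, sub_smul, e2]; abel
  have h3 := congrArg norm key
  rw [norm_smul, Real.norm_of_nonneg (h2.trans_le h1).le] at h3
  have hd : 0 ≤ 2 * π * (C * d) := (norm_nonneg _).trans hI
  have h4 : 2 * π * c * ‖multiplier j h - multiplier j' h'‖
      ≤ 2 * π * (C * d) + 2 * π * (C * d) * (C / c) := by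
    refine (mul_le_mul_of_nonneg_right h1 (norm_nonneg _)).trans (h3.le.trans ?_)
    refine (norm_sub_le _ _).trans (add_le_add (by rwa [norm_neg]) ?_)
    rw [norm_smul]
    exact mul_le_mul hJ hμ (norm_nonneg _) hd
  have h6 : 0 < 2 * π := by positivity
  have h7 : c * ‖multiplier j h - multiplier j' h'‖ ≤ (C + C * (C / c)) * d := by
    have : 2 * π * (c * ‖multiplier j h - multiplier j' h'‖)
        ≤ 2 * π * ((C + C * (C / c)) * d) := by linarith
    exact le_of_mul_le_mul_left this h6
  rw [div_mul_eq_mul_div, le_div_iff₀ hc0]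
  linarith

end Multiplier

/-- The linear form `v ↦ 2πR (v₁ μ₂ - v₂ μ₁)`. -/
def symplForm (R : ℝ) (μ : ℝ × ℝ) : ℝ × ℝ →L[ℝ] ℝ :=
  (2 * π * R) • (μ.2 • ContinuousLinearMap.fst ℝ ℝ ℝ - μ.1 • ContinuousLinearMap.snd ℝ ℝ ℝ)

lemma symplForm_apply (R : ℝ) (μ v : ℝ × ℝ) :
    symplForm R μ v = 2 * π * R * (μ.2 * v.1 - μ.1 * v.2) := by
  simp [symplForm]

lemma symplForm_swap (R : ℝ) (μ v : ℝ × ℝ) : symplForm R μ v = -symplForm R v μ := by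
  simp only [symplForm_apply]; ring

lemma norm_symplForm_sub_le {R : ℝ} (hR : 0 < R) (μ ν : ℝ × ℝ) :
    ‖symplForm R μ - symplForm R ν‖ ≤ 4 * π * R * ‖μ - ν‖ := by
  refine ContinuousLinearMap.opNorm_le_bound _ (by positivity) fun v => ?_
  have e : (symplForm R μ - symplForm R ν) v
      = 2 * π * R * ((μ - ν).2 * v.1 - (μ - ν).1 * v.2) := by
    simp only [sub_apply, symplForm_apply, Prod.fst_sub, Prod.snd_sub]; ring
  rw [e, norm_mul, Real.norm_of_nonneg (by positivity : 0 ≤ 2 * π * R)]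
  have h : ‖(μ - ν).2 * v.1 - (μ - ν).1 * v.2‖ ≤ 2 * (‖μ - ν‖ * ‖v‖) := by
    refine (norm_sub_le _ _).trans ?_
    rw [norm_mul, norm_mul]
    have h1 := mul_le_mul (norm_snd_le (μ - ν)) (norm_fst_le v) (norm_nonneg _) (norm_nonneg _)
    have h2 := mul_le_mul (norm_fst_le (μ - ν)) (norm_snd_le v) (norm_nonneg _) (norm_nonneg _)
    linarith
  calc _ ≤ 2 * π * R * (2 * (‖μ - ν‖ * ‖v‖)) := by gcongr
    _ = _ := by ring

lemma eq_zero_of_symplForm_eq_zero {R : ℝ} (hR : 0 < R) {μ : ℝ × ℝ} (h : symplForm R μ = 0) :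
    μ = 0 := by
  have h1 := symplForm_apply R μ (1, 0)
  have h2 := symplForm_apply R μ (0, 1)
  have hne : 2 * π * R ≠ 0 := by positivity
  rw [h] at h1 h2
  simp only [zero_apply, mul_one, mul_zero, sub_zero, zero_sub] at h1 h2
  ext
  · simpa [hR.ne', pi_ne_zero] using h2
  · simpa [hR.ne', pi_ne_zero] using h1

lemma contDiffOn_one_of_hasFDerivAt {E F : Type*} [NormedAddCommGroup E] [NormedSpace ℝ E]
    [NormedAddCommGroup F] [NormedSpace ℝ F] {f : E → F} {f' : E → E →L[ℝ] F} {V : Set E}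
    (hV : IsOpen V) (hf : ∀ z ∈ V, HasFDerivAt f (f' z) z) (hf' : ContinuousOn f' V) :
    ContDiffOn ℝ 1 f V := by
  have h := contDiffOn_succ_iff_fderiv_of_isOpen (𝕜 := ℝ) (n := 0) (f := f) hV
  rw [zero_add] at h
  rw [h]
  refine ⟨fun z hz => (hf z hz).differentiableAt.differentiableWithinAt, by simp, ?_⟩
  rw [contDiffOn_zero]
  exact hf'.congr fun z hz => (hf z hz).fderiv

/-- The action at the unperturbed circles. -/
def circAction (k R : ℝ) (κ : ℝ × ℝ → ℝ) (z : ℝ × ℝ) : ℝ :=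
  ∫ t in (0 : ℝ)..(2 * π), lagr k R 0 κ (t, z, 0)

/-- The multiplier at the unperturbed circles. -/
def circMultiplier (k R : ℝ) (κ : ℝ × ℝ → ℝ) (z : ℝ × ℝ) : ℝ × ℝ :=
  multiplier (fun t => normFactor k R κ 0 t z) (fun t => normFactor k R κ 0 t z • forcing k R κ t z)

lemma circMultiplier_eq {k R : ℝ} (hR : 0 < R) (κ : ℝ × ℝ → ℝ) {z : ℝ × ℝ} (hz : 0 < z.2) :
    circMultiplier k R κ z = -((2 * π)⁻¹ • ∫ t in (0 : ℝ)..(2 * π), forcing k R κ t z) := by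
  have h0 : (R * z.2) ^ 2 ≠ 0 := by positivity
  simp only [circMultiplier, multiplier, normFactor, zero_mul, add_zero, div_one,
    intervalIntegral.integral_smul, intervalIntegral.integral_const, sub_zero, smul_smul,
    smul_eq_mul]
  congr 2
  field_simp

lemma hasFDerivAt_circAction {k R : ℝ} (hR : 0 < R) {κ : ℝ × ℝ → ℝ} (hκ : ContDiff ℝ 1 κ)
    {V W : Set (ℝ × ℝ)} (hV : IsOpen V) (hW : IsCompact W) (hWc : Convex ℝ W)
    (hWpos : ∀ a ∈ W, 0 < a.2) (hVW : V ⊆ W) {z : ℝ × ℝ} (hz : z ∈ V) :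
    HasFDerivAt (circAction k R κ) (symplForm R (circMultiplier k R κ z)) z := by
  have hfc : Continuous fun t => forcing k R κ t z :=
    (contDiff_forcing (k := k) (R := R) hκ).continuous.comp (by fun_prop : Continuous fun t : ℝ => (t, z))
  refine hasFDerivAt_action (q := fun z _ => z) (b := fun _ _ => 0) (Cb := 0) (Cl := 1) hR hκ hV hW
    hWc hWpos (fun z _ t => hasDerivAt_const t z) (fun _ _ => continuous_const) (fun _ _ _ => rfl)
    (fun z hz _ => hVW hz) (by simp) (by simp) (by simp) hz _ fun z' _ => ?_
  have e : ∀ t, eulerLagr k R 0 κ t z 0 (z' - z)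
      = (2 * π)⁻¹ * symplForm R (z' - z) (forcing k R κ t z) := by
    intro t
    simp only [eulerLagr, symplForm_apply, forcing, Prod.smul_mk, smul_eq_mul, Prod.fst_zero,
      Prod.snd_zero]
    field_simp
    ring
  simp_rw [e]
  rw [intervalIntegral.integral_const_mul,
    (symplForm R (z' - z)).intervalIntegral_comp_comm (hfc.intervalIntegrable _ _),
    circMultiplier_eq hR κ (hWpos z (hVW hz)), symplForm_swap R _ (z' - z), map_neg, map_smul,
    neg_neg, smul_eq_mul]


lemma eulerLagr_of_eq {k R ε : ℝ} (hε : ε ≠ 0) (hR : 0 < R) {κ : ℝ × ℝ → ℝ} {θ : ℝ} {a : ℝ × ℝ}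
    (ha : 0 < a.2) (hden : 1 + ε * (κ (circPt k R θ a) * (k - cos θ) * (R * a.2) ^ 2) ≠ 0)
    (μ w : ℝ × ℝ) :
    eulerLagr k R ε⁻¹ κ θ a (ε • (normFactor k R κ ε θ a • forcing k R κ θ a
      + normFactor k R κ ε θ a • μ)) w = (2 * π)⁻¹ * symplForm R μ w := by
  have ha2 := ha.ne'
  have hR2 := hR.ne'
  have hJ : ε * normFactor k R κ ε θ a
      * (ε⁻¹ / (R * a.2) ^ 2 + κ (circPt k R θ a) * (k - cos θ)) = 1 := by
    rw [normFactor, mul_div_assoc', div_mul_eq_mul_div, div_eq_one_iff_eq hden]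
    field_simp
  simp only [eulerLagr, symplForm_apply, forcing, Prod.smul_mk, smul_eq_mul, Prod.fst_add,
    Prod.snd_add, Prod.smul_fst, Prod.smul_snd]
  have e : (2 * π)⁻¹ * (2 * π * R * (μ.2 * w.1 - μ.1 * w.2)) = R * (μ.2 * w.1 - μ.1 * w.2) := by
    field_simp
  rw [e]
  linear_combination (R * (w.1 * (-(κ (circPt k R θ a) * a.2) * sin θ + μ.2)
    - w.2 * (-(κ (circPt k R θ a) * a.2) * (R * (k * cos θ - 1)) + μ.1))) * hJ

/-- Finite-dimensional reduction: critical points of a `C¹`-small perturbation of the action of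
circles yield periodic solutions of the equation for the moving center. -/
theorem exists_reduction {k R : ℝ} (hR : 0 < R) {κ : ℝ × ℝ → ℝ} (hκ : ContDiff ℝ 1 κ)
    {V W : Set (ℝ × ℝ)} (hV : IsOpen V) (hVc : Convex ℝ V) (hW : IsCompact W) (hWc : Convex ℝ W)
    {m δ : ℝ} (hm : 0 < m) (hWm : ∀ a ∈ W, m ≤ a.2) (hδ : 0 < δ)
    (hVW : ∀ z ∈ V, ∀ a, ‖a - z‖ ≤ δ → a ∈ W) {z₁ : ℝ × ℝ} (hz₁ : z₁ ∈ V)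
    {pr : ℝ × ℝ → ℝ × ℝ} (hprW : ∀ a, pr a ∈ W) (hprid : ∀ a ∈ W, pr a = a)
    (hprl : ∀ a a', ‖pr a - pr a'‖ ≤ ‖a - a'‖) :
    ContDiffOn ℝ 1 (circAction k R κ) V ∧
    ∃ ε₁ > 0, ∃ C > 0, ∀ ε, ε ≠ 0 → |ε| ≤ ε₁ → ∃ G : ℝ × ℝ → ℝ, ContDiffOn ℝ 1 G V ∧
      (∀ z ∈ V, |G z - circAction k R κ z| ≤ C * |ε|) ∧
      (∀ z ∈ V, ‖fderiv ℝ G z - fderiv ℝ (circAction k R κ) z‖ ≤ C * |ε|) ∧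
      ∀ z ∈ V, fderiv ℝ G z = 0 → ∃ q : ℝ → ℝ × ℝ, Function.Periodic q (2 * π) ∧
        (∀ t, q t ∈ W) ∧ (∀ t, ‖q t - z‖ ≤ C * |ε|) ∧
        (∀ t, 1 / 2 ≤ 1 + ε * (κ (circPt k R t (q t)) * (k - cos t) * (R * (q t).2) ^ 2)) ∧
        ∀ t, HasDerivAt q (ε • (normFactor k R κ ε t (q t) • forcing k R κ t (q t))) t := by
  have hVW' : V ⊆ W := fun z hz => hVW z hz z (by simpa using hδ.le)
  have hWpos : ∀ a ∈ W, 0 < a.2 := fun a ha => hm.trans_le (hWm a ha)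
  obtain ⟨ε₁, hε₁, c, hc, C, hC, hbd, hlip⟩ := exists_normFactor_bounds (k := k) hR hκ hW hWc hm hWm
  obtain ⟨Dm, hDm⟩ := hW.isBounded.exists_norm_le
  have hDm0 : 0 ≤ Dm := (norm_nonneg _).trans (hDm z₁ (hVW' hz₁))
  set M : ℝ := (C + C * (C / c)) / c with hM
  set C₂ : ℝ := C + C * (C / c) + C * M with hC₂
  have hM0 : 0 < M := by positivity
  have hC₂0 : 0 < C₂ := by positivity
  -- the reduced vector field
  set J : ℝ → (ℝ → ℝ × ℝ) → ℝ → ℝ := fun ε q t => normFactor k R κ ε t (pr (q t)) with hJ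
  set H : ℝ → (ℝ → ℝ × ℝ) → ℝ → ℝ × ℝ := fun ε q t => J ε q t • forcing k R κ t (pr (q t)) with hH
  set N : ℝ → (ℝ → ℝ × ℝ) → ℝ → ℝ × ℝ :=
    fun ε q t => H ε q t + J ε q t • multiplier (J ε q) (H ε q) with hN
  have hprc : Continuous pr := by
    have : LipschitzWith 1 pr := LipschitzWith.of_dist_le_mul fun a a' => by
      simpa [dist_eq_norm] using hprl a a'
    exact this.continuous
  have hJc : ∀ ε, |ε| ≤ ε₁ → ∀ q, Continuous q → Continuous (J ε q) := by
    intro ε hε q hq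
    have h1 : Continuous fun t => κ (circPt k R t (pr (q t))) := by
      have := hκ.continuous
      unfold circPt
      fun_prop
    simp only [hJ, normFactor]
    refine Continuous.div (by fun_prop) (continuous_const.add (continuous_const.mul
      ((h1.mul (by fun_prop)).mul (by fun_prop)))) fun t => ?_
    have := (hbd ε hε t _ (hprW (q t))).1
    linarith
  have hfc : ∀ q : ℝ → ℝ × ℝ, Continuous q → Continuous fun t => forcing k R κ t (pr (q t)) :=
    fun q hq => (contDiff_forcing (k := k) (R := R) hκ).continuous.comp
      (by fun_prop : Continuous fun t : ℝ => (t, pr (q t)))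
  have hHc : ∀ ε, |ε| ≤ ε₁ → ∀ q, Continuous q → Continuous (H ε q) := fun ε hε q hq =>
    (hJc ε hε q hq).smul (hfc q hq)
  have hJlb : ∀ ε, |ε| ≤ ε₁ → ∀ q t, c ≤ J ε q t := fun ε hε q t => (hbd ε hε t _ (hprW _)).2.1
  have hJub : ∀ ε, |ε| ≤ ε₁ → ∀ q t, ‖J ε q t‖ ≤ C := fun ε hε q t => by
    rw [Real.norm_of_nonneg (hc.le.trans (hJlb ε hε q t))]
    exact (hbd ε hε t _ (hprW _)).2.2.1
  have hHub : ∀ ε, |ε| ≤ ε₁ → ∀ q t, ‖H ε q t‖ ≤ C := fun ε hε q t => (hbd ε hε t _ (hprW _)).2.2.2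
  have hμub : ∀ ε, |ε| ≤ ε₁ → ∀ q, Continuous q → ‖multiplier (J ε q) (H ε q)‖ ≤ C / c :=
    fun ε hε q hq => norm_multiplier_le (hJc ε hε q hq) hc (hJlb ε hε q) (hHub ε hε q)
  have hJl : ∀ ε ε', |ε| ≤ ε₁ → |ε'| ≤ ε₁ → ∀ q q' : ℝ → ℝ × ℝ, ∀ d, (∀ t, ‖q t - q' t‖ ≤ d) →
      ∀ t, |J ε q t - J ε' q' t| ≤ C * (|ε - ε'| + d) := fun ε ε' hε hε' q q' d hd t =>
    (hlip ε ε' hε hε' t _ (hprW _) _ (hprW _)).1.trans (by gcongr; exact (hprl _ _).trans (hd t))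
  have hHl : ∀ ε ε', |ε| ≤ ε₁ → |ε'| ≤ ε₁ → ∀ q q' : ℝ → ℝ × ℝ, ∀ d, (∀ t, ‖q t - q' t‖ ≤ d) →
      ∀ t, ‖H ε q t - H ε' q' t‖ ≤ C * (|ε - ε'| + d) := fun ε ε' hε hε' q q' d hd t =>
    (hlip ε ε' hε hε' t _ (hprW _) _ (hprW _)).2.trans (by gcongr; exact (hprl _ _).trans (hd t))
  have hμl : ∀ ε ε', |ε| ≤ ε₁ → |ε'| ≤ ε₁ → ∀ q q' : ℝ → ℝ × ℝ, Continuous q → Continuous q' →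
      ∀ d, (∀ t, ‖q t - q' t‖ ≤ d) →
      ‖multiplier (J ε q) (H ε q) - multiplier (J ε' q') (H ε' q')‖ ≤ M * (|ε - ε'| + d) :=
    fun ε ε' hε hε' q q' hq hq' d hd => norm_multiplier_sub_le (hJc ε hε q hq) (hJc ε' hε' q' hq')
      hc (hJlb ε hε q) (hJlb ε' hε' q') (hHc ε hε q hq) (hHc ε' hε' q' hq') (hHub ε' hε' q')
      (hJl ε ε' hε hε' q q' d hd) (hHl ε ε' hε hε' q q' d hd)
  have hNub : ∀ ε, |ε| ≤ ε₁ → ∀ q, Continuous q → ∀ t, ‖N ε q t‖ ≤ C₂ := by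
    intro ε hε q hq t
    have h1 : ‖N ε q t‖ ≤ C + C * (C / c) := by
      refine (norm_add_le _ _).trans (add_le_add (hHub ε hε q t) ?_)
      rw [norm_smul]
      exact mul_le_mul (hJub ε hε q t) (hμub ε hε q hq) (norm_nonneg _) hC.le
    have : 0 ≤ C * M := by positivity
    linarith
  have hNl : ∀ ε, |ε| ≤ ε₁ → ∀ q q' : ℝ → ℝ × ℝ, Continuous q → Continuous q' →
      ∀ d, (∀ t, ‖q t - q' t‖ ≤ d) → ∀ t, ‖N ε q t - N ε q' t‖ ≤ C₂ * d := by
    intro ε hε q q' hq hq' d hd t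
    have h1 := hJl ε ε hε hε q q' d hd t
    have h2 := hHl ε ε hε hε q q' d hd t
    have h3 := hμl ε ε hε hε q q' hq hq' d hd
    simp only [sub_self, abs_zero, zero_add] at h1 h2 h3
    have e : N ε q t - N ε q' t = (H ε q t - H ε q' t)
        + ((J ε q t - J ε q' t) • multiplier (J ε q') (H ε q')
        + J ε q t • (multiplier (J ε q) (H ε q) - multiplier (J ε q') (H ε q'))) := by
      simp only [hN, sub_smul, smul_sub]; abel
    have h4 : ‖(J ε q t - J ε q' t) • multiplier (J ε q') (H ε q')‖ ≤ C * d * (C / c) := by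
      rw [norm_smul]
      exact mul_le_mul h1 (hμub ε hε q' hq') (norm_nonneg _) ((abs_nonneg _).trans h1)
    have h5 : ‖J ε q t • (multiplier (J ε q) (H ε q) - multiplier (J ε q') (H ε q'))‖
        ≤ C * (M * d) := by
      rw [norm_smul]
      exact mul_le_mul (hJub ε hε q t) h3 (norm_nonneg _) hC.le
    rw [e]
    refine (norm_add_le _ _).trans ((add_le_add h2 ((norm_add_le _ _).trans
      (add_le_add h4 h5))).trans (le_of_eq ?_))
    rw [hC₂]; ring
  have hJμc : ∀ ε, |ε| ≤ ε₁ → ∀ q, Continuous q →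
      Continuous fun t => J ε q t • multiplier (J ε q) (H ε q) := fun ε hε q hq =>
    (hJc ε hε q hq).smul continuous_const
  have hNc : ∀ ε, |ε| ≤ ε₁ → ∀ q, Continuous q → Continuous (N ε q) := fun ε hε q hq =>
    (hHc ε hε q hq).add (hJμc ε hε q hq)
  have hF : ∀ z ∈ V, HasFDerivAt (circAction k R κ) (symplForm R (circMultiplier k R κ z)) z :=
    fun z hz => hasFDerivAt_circAction hR hκ hV hW hWc hWpos hVW' hz
  have h0 : |(0 : ℝ)| ≤ ε₁ := by simpa using hε₁.le
  have hcm : ∀ z ∈ V, circMultiplier k R κ z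
      = multiplier (J 0 fun _ => z) (H 0 fun _ => z) := fun z hz => by
    simp only [circMultiplier, hJ, hH, hprid z (hVW' hz)]
  have hcont : ∀ μ : ℝ × ℝ → ℝ × ℝ, (∀ z ∈ V, ∀ z' ∈ V, ‖μ z - μ z'‖ ≤ 2 * M * ‖z - z'‖) →
      ContinuousOn (fun z => symplForm R (μ z)) V := by
    intro μ hμ
    have : LipschitzOnWith (4 * π * R * (2 * M)).toNNReal (fun z => symplForm R (μ z)) V :=
      LipschitzOnWith.of_dist_le_mul fun z hz z' hz' => by
        rw [dist_eq_norm, dist_eq_norm, Real.coe_toNNReal _ (by positivity), mul_assoc]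
        exact (norm_symplForm_sub_le hR _ _).trans (by gcongr; exact hμ z hz z' hz')
    exact this.continuousOn
  refine ⟨contDiffOn_one_of_hasFDerivAt hV hF (hcont _ fun z hz z' hz' => ?_), ?_⟩
  · rw [hcm z hz, hcm z' hz']
    have := hμl 0 0 h0 h0 (fun _ => z) (fun _ => z') continuous_const continuous_const ‖z - z'‖
      (fun _ => le_rfl)
    simp only [sub_self, abs_zero, zero_add] at this
    nlinarith [norm_nonneg (z - z'), mul_nonneg hM0.le (norm_nonneg (z - z'))]
  set C₃ : ℝ := 4 * π * R * (M * (1 + 4 * π * C₂)) with hC₃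
  have hC₃0 : 0 < C₃ := by positivity
  refine ⟨min ε₁ (min (1 / (8 * π * C₂)) (δ / (4 * π * C₂))), by positivity,
    4 * π * C₂ + C₃ + C₃ * (2 * Dm), by positivity, fun ε hε0 hε => ?_⟩
  have hεa : |ε| ≤ ε₁ := hε.trans (min_le_left _ _)
  have hεb : |ε| * (8 * π * C₂) ≤ 1 := by
    have := hε.trans ((min_le_right _ _).trans (min_le_left _ _))
    rwa [le_div_iff₀ (by positivity)] at this
  have hεc : 4 * π * C₂ * |ε| ≤ δ := by
    have := hε.trans ((min_le_right _ _).trans (min_le_right _ _))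
    rw [le_div_iff₀ (by positivity)] at this
    linarith
  obtain ⟨q, hqc, hqp, hqd, hqm, hqz, hql⟩ := exists_periodic_family (N ε) C₂
    (fun q hq _ => hNc ε hεa q hq)
    (fun q hq hqp t => by
      simp only [hN, hH, hJ, hqp t, normFactor_add_two_pi, forcing_add_two_pi])
    (fun q hq _ => by
      simp only [hN]
      rw [intervalIntegral.integral_add ((hHc ε hεa q hq).intervalIntegrable _ _)
        ((hJμc ε hεa q hq).intervalIntegrable _ _),
        intervalIntegral.integral_smul_const,
        integral_smul_multiplier (hJc ε hεa q hq) hc (hJlb ε hεa q), add_neg_cancel])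
    (fun q hq _ => hNub ε hεa q hq) (fun q q' hq _ hq' _ => hNl ε hεa q q' hq hq') ε hεb
  have hqW : ∀ z ∈ V, ∀ t, q z t ∈ W := fun z hz t => hVW z hz _ ((hqz z t).trans hεc)
  set μ : ℝ × ℝ → ℝ × ℝ := fun z => multiplier (J ε (q z)) (H ε (q z)) with hμ
  set G₀ : ℝ × ℝ → ℝ := fun z => ∫ t in (0 : ℝ)..(2 * π),
    lagr k R ε⁻¹ κ (t, q z t, ε • N ε (q z) t) with hG₀
  have hG₀d : ∀ z ∈ V, HasFDerivAt G₀ (symplForm R (μ z)) z := by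
    intro z hz
    refine hasFDerivAt_action (Cb := |ε| * C₂) (Cl := 2 + |ε| * (C₂ * 2)) hR hκ hV hW hWc hWpos
      (fun z _ t => hqd z t) (fun z _ => ?_) (fun z _ => hqp z) hqW ?_ ?_ ?_ hz _ fun z' hz' => ?_
    · exact (hNc ε hεa _ (hqc z)).const_smul ε
    · intro z _ t
      rw [norm_smul, Real.norm_eq_abs]
      gcongr
      exact hNub ε hεa _ (hqc z) t
    · intro z _ z' _ t
      refine (hql z z' t).trans ?_
      gcongr
      have : 0 ≤ |ε| * (C₂ * 2) := by positivity
      linarith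
    · intro z _ z' _ t
      rw [← smul_sub, norm_smul, Real.norm_eq_abs]
      have := hNl ε hεa _ _ (hqc z) (hqc z') _ (hql z z') t
      calc |ε| * ‖N ε (q z) t - N ε (q z') t‖ ≤ |ε| * (C₂ * (2 * ‖z - z'‖)) := by gcongr
        _ ≤ (2 + |ε| * (C₂ * 2)) * ‖z - z'‖ := by nlinarith [norm_nonneg (z - z')]
    · have e : ∀ t, eulerLagr k R ε⁻¹ κ t (q z t) (ε • N ε (q z) t) (q z' t - q z t)
          = (2 * π)⁻¹ * symplForm R (μ z) (q z' t - q z t) := by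
        intro t
        have h1 := (hbd ε hεa t _ (hqW z hz t)).1
        rw [← eulerLagr_of_eq hε0 hR (hWpos _ (hqW z hz t)) (by linarith) (μ z)]
        simp only [hN, hH, hJ, hμ, hprid _ (hqW z hz t)]
      have hd : Continuous fun t => q z' t - q z t := (hqc z').sub (hqc z)
      simp_rw [e]
      rw [intervalIntegral.integral_const_mul,
        (symplForm R (μ z)).intervalIntegral_comp_comm (hd.intervalIntegrable _ _),
        intervalIntegral.integral_sub ((hqc z').intervalIntegrable _ _)
          ((hqc z).intervalIntegrable _ _), hqm, hqm, ← smul_sub, map_smul, smul_eq_mul,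
        inv_mul_cancel_left₀ (by positivity)]
  have hμd : ∀ z ∈ V, ‖symplForm R (μ z) - symplForm R (circMultiplier k R κ z)‖ ≤ C₃ * |ε| := by
    intro z hz
    refine (norm_symplForm_sub_le hR _ _).trans ?_
    have h1 := hμl ε 0 hεa h0 (q z) (fun _ => z) (hqc z) continuous_const _ (hqz z)
    rw [← hcm z hz, sub_zero] at h1
    calc _ ≤ 4 * π * R * (M * (|ε| + 4 * π * C₂ * |ε|)) := by gcongr
      _ = C₃ * |ε| := by rw [hC₃]; ring
  set G : ℝ × ℝ → ℝ := fun z => G₀ z + (circAction k R κ z₁ - G₀ z₁) with hG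
  have hGd : ∀ z ∈ V, HasFDerivAt G (symplForm R (μ z)) z := fun z hz =>
    (hG₀d z hz).add_const _
  have hC₃le : C₃ * |ε| ≤ (4 * π * C₂ + C₃ + C₃ * (2 * Dm)) * |ε| := by
    gcongr
    have : 0 ≤ 4 * π * C₂ := by positivity
    have : 0 ≤ C₃ * (2 * Dm) := by positivity
    linarith
  refine ⟨G, contDiffOn_one_of_hasFDerivAt hV hGd (hcont _ fun z hz z' hz' => ?_),
    fun z hz => ?_, fun z hz => ?_, fun z hz hz0 => ?_⟩
  · have := hμl ε ε hεa hεa (q z) (q z') (hqc z) (hqc z') _ (hql z z')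
    simp only [sub_self, abs_zero, zero_add] at this
    exact this.trans (le_of_eq (by ring))
  · have h1 := hVc.norm_image_sub_le_of_norm_hasFDerivWithin_le
      (f := fun z => G z - circAction k R κ z)
      (fun z hz => ((hGd z hz).sub (hF z hz)).hasFDerivWithinAt) hμd hz₁ hz
    have h2 : G z₁ - circAction k R κ z₁ = 0 := by simp only [hG]; ring
    rw [h2, sub_zero, Real.norm_eq_abs] at h1
    have h3 : ‖z - z₁‖ ≤ 2 * Dm := by
      have := norm_sub_le z z₁
      linarith [hDm z (hVW' hz), hDm z₁ (hVW' hz₁)]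
    refine h1.trans ?_
    calc C₃ * |ε| * ‖z - z₁‖ ≤ C₃ * |ε| * (2 * Dm) := by gcongr
      _ = C₃ * (2 * Dm) * |ε| := by ring
      _ ≤ _ := by
        gcongr
        have : 0 ≤ 4 * π * C₂ := by positivity
        linarith
  · rw [(hGd z hz).fderiv, (hF z hz).fderiv]
    exact (hμd z hz).trans hC₃le
  · rw [(hGd z hz).fderiv] at hz0
    have hμ0 := eq_zero_of_symplForm_eq_zero hR hz0
    refine ⟨q z, hqp z, hqW z hz, fun t => (hqz z t).trans ?_,
      fun t => (hbd ε hεa t _ (hqW z hz t)).1, fun t => ?_⟩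
    · gcongr
      have : 0 ≤ C₃ * (2 * Dm) := by positivity
      linarith
    · have := hqd z t
      simp only [hμ] at hμ0
      simp only [hN, hμ0, smul_zero, add_zero] at this
      simpa only [hH, hJ, hprid _ (hqW z hz t)] using this

lemma mem_EBall_iff_abs_lt_sqrt (c : ℝ × ℝ) (r x y : ℝ) :
    (x, y) ∈ EBall c r ↔ y ∈ Set.Ioo (c.2 - √(r ^ 2 - (x - c.1) ^ 2))
      (c.2 + √(r ^ 2 - (x - c.1) ^ 2)) := by
  have h : (x, y) ∈ EBall c r ↔ |y - c.2| < √(r ^ 2 - (x - c.1) ^ 2) := by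
    rw [Real.lt_sqrt (abs_nonneg _), sq_abs]
    simp only [EBall, Set.mem_ofPred_eq]
    constructor <;> intro h <;> linarith
  rw [h, abs_lt, Set.mem_Ioo]
  constructor <;> rintro ⟨h1, h2⟩ <;> constructor <;> linarith

lemma EBall_subset_Icc (c : ℝ × ℝ) {r : ℝ} (hr : 0 < r) :
    EBall c r ⊆ Set.Icc (c.1 - r) (c.1 + r) ×ˢ Set.Icc (c.2 - r) (c.2 + r) := by
  rintro ⟨x, y⟩ h
  simp only [EBall, Set.mem_ofPred_eq] at h
  have h1 : |x - c.1| ≤ r := abs_le_of_sq_le_sq (by nlinarith [sq_nonneg (y - c.2)]) hr.le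
  have h2 : |y - c.2| ≤ r := abs_le_of_sq_le_sq (by nlinarith [sq_nonneg (x - c.1)]) hr.le
  rw [abs_le] at h1 h2
  exact ⟨⟨by linarith, by linarith⟩, ⟨by linarith, by linarith⟩⟩

lemma isOpen_EBall (c : ℝ × ℝ) (r : ℝ) : IsOpen (EBall c r) :=
  isOpen_lt (by fun_prop) (by fun_prop)

lemma intervalIntegral_eq_areaPotential_sub {κ : ℝ × ℝ → ℝ} (hκ : Continuous κ) (x a b : ℝ) :
    ∫ y in a..b, κ (x, y) = areaPotential κ (x, a) - areaPotential κ (x, b) := by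
  have hc : Continuous fun y => κ (x, y) := by fun_prop
  have := intervalIntegral.integral_add_adjacent_intervals (hc.intervalIntegrable (μ := volume) 0 a)
    (hc.intervalIntegrable a b)
  simp only [areaPotential]
  linarith

/-- Green's formula on a disk. -/
lemma integral_EBall_eq {κ : ℝ × ℝ → ℝ} (hκ : ContDiff ℝ 1 κ) (c : ℝ × ℝ) {r : ℝ} (hr : 0 < r) :
    ∫ p in EBall c r, κ p = ∫ t in (0 : ℝ)..(2 * π),
      areaPotential κ (c.1 + r * sin t, c.2 - r * cos t) * (r * cos t) := by
  have hκc := hκ.continuous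
  have hQ := (contDiff_areaPotential hκ).continuous
  set h : ℝ → ℝ := fun x => √(r ^ 2 - (x - c.1) ^ 2) with hh
  have hhc : Continuous h := by fun_prop
  set g : ℝ → ℝ := fun x => areaPotential κ (x, c.2 - h x) - areaPotential κ (x, c.2 + h x) with hg
  have hgc : Continuous g := by fun_prop
  have hint : Integrable ((EBall c r).indicator κ) := by
    rw [integrable_indicator_iff (isOpen_EBall c r).measurableSet]
    exact (hκc.continuousOn.integrableOn_compact
      (isCompact_Icc.prod isCompact_Icc)).mono_set (EBall_subset_Icc c hr)
  have hinner : ∀ x, ∫ y, (EBall c r).indicator κ (x, y) = g x := by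
    intro x
    have e : (fun y => (EBall c r).indicator κ (x, y))
        = (Set.Ioo (c.2 - h x) (c.2 + h x)).indicator fun y => κ (x, y) := by
      ext y
      simp only [Set.indicator, mem_EBall_iff_abs_lt_sqrt, hh]
    have hx : 0 ≤ h x := Real.sqrt_nonneg _
    rw [e, integral_indicator measurableSet_Ioo, ← integral_Ioc_eq_integral_Ioo,
      ← intervalIntegral.integral_of_le (by linarith), intervalIntegral_eq_areaPotential_sub hκc]
  have hline : ∫ p in EBall c r, κ p = ∫ x in (c.1 - r)..(c.1 + r), g x := by
    rw [← integral_indicator (isOpen_EBall c r).measurableSet, Measure.volume_eq_prod,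
      integral_prod _ (by rw [← Measure.volume_eq_prod]; exact hint)]
    simp_rw [hinner]
    rw [intervalIntegral.integral_of_le (by linarith)]
    refine (setIntegral_eq_integral_of_forall_compl_eq_zero fun x hx => ?_).symm
    have hx' : r ^ 2 - (x - c.1) ^ 2 ≤ 0 := by
      by_contra hpos
      have h1 : |x - c.1| < r := abs_lt_of_sq_lt_sq (by linarith) hr.le
      rw [abs_lt] at h1
      exact hx ⟨by linarith, by linarith⟩
    simp [hg, hh, Real.sqrt_eq_zero'.2 hx']
  have hsub : ∫ x in (c.1 - r)..(c.1 + r), g x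
      = ∫ t in (-(π / 2))..(π / 2), g (c.1 + r * sin t) * (r * cos t) := by
    have := intervalIntegral.integral_comp_mul_deriv (a := -(π / 2)) (b := π / 2)
      (f := fun t => c.1 + r * sin t) (f' := fun t => r * cos t) (g := g)
      (fun t _ => ((hasDerivAt_sin t).const_mul r).const_add c.1) (by fun_prop) hgc
    simp only [sin_neg, sin_pi_div_two, mul_one, mul_neg, ← sub_eq_add_neg] at this
    rw [← this]
    rfl
  set f : ℝ → ℝ := fun t => areaPotential κ (c.1 + r * sin t, c.2 - r * cos t) * (r * cos t) with hf
  have hfc : Continuous f := by fun_prop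
  have hfp : Function.Periodic f (2 * π) := fun t => by simp [hf]
  have hsplit : ∫ t in (-(π / 2))..(π / 2), g (c.1 + r * sin t) * (r * cos t)
      = ∫ t in (-(π / 2))..(π / 2), (f t + f (π - t)) := by
    refine intervalIntegral.integral_congr fun t ht => ?_
    rw [Set.uIcc_of_le (by linarith [pi_pos])] at ht
    have hcos : 0 ≤ cos t := cos_nonneg_of_mem_Icc ht
    have h1 : h (c.1 + r * sin t) = r * cos t := by
      have : r ^ 2 - (c.1 + r * sin t - c.1) ^ 2 = (r * cos t) ^ 2 := by
        have := sin_sq_add_cos_sq t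
        linear_combination -r ^ 2 * this
      simp only [hh, this]
      exact Real.sqrt_sq (by positivity)
    simp only [hg, hf, h1, sin_pi_sub, cos_pi_sub]
    ring_nf
  have hrefl : ∫ t in (-(π / 2))..(π / 2), f (π - t)
      = ∫ t in (π / 2)..(-(π / 2) + 2 * π), f t := by
    rw [intervalIntegral.integral_comp_sub_left (fun t => f t) π]
    congr 1 <;> ring
  have hfc' : Continuous fun t => f (π - t) := by fun_prop
  rw [hline, hsub, hsplit, intervalIntegral.integral_add (hfc.intervalIntegrable _ _)
    (hfc'.intervalIntegrable _ _), hrefl, intervalIntegral.integral_add_adjacent_intervals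
    (hfc.intervalIntegrable _ _) (hfc.intervalIntegrable _ _)]
  simpa using hfp.intervalIntegral_add_eq (-(π / 2)) 0

lemma Fmel_eq_circAction {k : ℝ} {K κ : ℝ × ℝ → ℝ} (hκ : ContDiff ℝ 1 κ)
    {y₀ : ℝ} (hκK : ∀ p : ℝ × ℝ, y₀ ≤ p.2 → κ p = K p / p.2 ^ 2) {z : ℝ × ℝ} (hz : 0 < z.2)
    (hy : y₀ ≤ (k - 1) * Rk k * z.2) (hR : 0 < Rk k) :
    Fmel k K z = circAction k (Rk k) κ z := by
  have hr : 0 < Rk k * z.2 := by positivity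
  have h1 : Fmel k K z = ∫ p in EBall ((z.1, k * Rk k * z.2) : ℝ × ℝ) (Rk k * z.2), κ p := by
    refine setIntegral_congr_fun (isOpen_EBall _ _).measurableSet fun p hp => ?_
    have := (EBall_subset_Icc _ hr hp).2.1
    simp only at this
    exact (hκK p (by nlinarith)).symm
  rw [h1, integral_EBall_eq hκ _ hr, circAction]
  refine intervalIntegral.integral_congr fun t _ => ?_
  simp only [lagr, circPt, Prod.fst_zero, Prod.snd_zero]
  ring_nf

lemma exists_angle_reparam {D : ℝ → ℝ} (hD : Continuous D) (hDp : Function.Periodic D (2 * π))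
    {c C L : ℝ} (hc : 0 < c) (hcD : ∀ t, c ≤ D t) (hDC : ∀ t, D t ≤ C)
    (hL : L = (2 * π)⁻¹ * ∫ t in (0 : ℝ)..(2 * π), (D t)⁻¹) :
    0 < L ∧ ∃ ϑ : ℝ → ℝ, (∀ t, HasDerivAt ϑ (L * D (ϑ t)) t) ∧
      (∀ t, ϑ (t + 2 * π) = ϑ t + 2 * π) ∧ (∀ t, ∫ s in (0 : ℝ)..ϑ t, (D s)⁻¹ = L * t) := by
  have hDpos : ∀ t, 0 < D t := fun t => hc.trans_le (hcD t)
  have hC : 0 < C := (hDpos 0).trans_le (hDC 0)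
  have hic : Continuous fun t => (D t)⁻¹ := hD.inv₀ fun t => (hDpos t).ne'
  have hilb : ∀ t, C⁻¹ ≤ (D t)⁻¹ := fun t => inv_anti₀ (hDpos t) (hDC t)
  have hint := le_integral_two_pi hic hilb
  have hLpos : 0 < L := by
    rw [hL]
    have : 0 < 2 * π * C⁻¹ := by positivity
    exact mul_pos (by positivity) (this.trans_le hint)
  refine ⟨hLpos, ?_⟩
  set I : ℝ → ℝ := fun x => ∫ s in (0 : ℝ)..x, (D s)⁻¹ with hI
  have hId : ∀ x, HasDerivAt I (D x)⁻¹ x := fun x =>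
    intervalIntegral.integral_hasDerivAt_right (hic.intervalIntegrable _ _)
      (hic.stronglyMeasurableAtFilter _ _) hic.continuousAt
  have hIc : Continuous I := continuous_iff_continuousAt.2 fun x => (hId x).continuousAt
  have hI0 : I 0 = 0 := by simp [hI]
  have hImono : StrictMono I := strictMono_of_deriv_pos fun x => by
    rw [(hId x).deriv]; exact inv_pos.2 (hDpos x)
  have hfm : Monotone fun x => I x - C⁻¹ * x := by
    have hd : ∀ x, HasDerivAt (fun x => I x - C⁻¹ * x) ((D x)⁻¹ - C⁻¹) x := fun x =>
      ((hId x).sub ((hasDerivAt_id x).const_mul C⁻¹)).congr_deriv (by simp)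
    refine monotone_of_deriv_nonneg (fun x => (hd x).differentiableAt) fun x => ?_
    rw [(hd x).deriv]
    linarith [hilb x]
  have hCi : 0 < C⁻¹ := inv_pos.2 hC
  have hItop : Tendsto I atTop atTop := by
    refine tendsto_atTop_mono' atTop ?_ (tendsto_id.const_mul_atTop hCi)
    filter_upwards [eventually_ge_atTop 0] with x hx
    have := hfm hx
    simp only [hI0, mul_zero, sub_zero] at this
    simp only [id]; linarith
  have hIbot : Tendsto I atBot atBot := by
    refine tendsto_atBot_mono' atBot ?_ (tendsto_id.const_mul_atBot hCi)
    filter_upwards [eventually_le_atBot 0] with x hx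
    have := hfm hx
    simp only [hI0, mul_zero, sub_zero] at this
    simp only [id]; linarith
  set e : ℝ ≃o ℝ := hImono.orderIsoOfSurjective I (hIc.surjective hItop hIbot) with he
  have heI : ∀ x, e x = I x := fun x => rfl
  have hright : ∀ y, I (e.symm y) = y := fun y => by rw [← heI, e.apply_symm_apply]
  have hperI : ∀ x, I (x + 2 * π) = I x + L * (2 * π) := by
    intro x
    have hip : Function.Periodic (fun t => (D t)⁻¹) (2 * π) := fun t => by simp [hDp t]
    have h1 := intervalIntegral.integral_add_adjacent_intervals
      (hic.intervalIntegrable (μ := volume) 0 x) (hic.intervalIntegrable x (x + 2 * π))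
    rw [hip.intervalIntegral_add_eq x 0, zero_add] at h1
    simp only [hI]
    rw [← h1, hL]
    field_simp
  refine ⟨fun t => e.symm (L * t), fun t => ?_, fun t => ?_, fun t => hright _⟩
  · have h1 : HasDerivAt e.symm (D (e.symm (L * t))) (L * t) := by
      have := HasDerivAt.of_local_left_inverse (f := I) (g := e.symm) (a := L * t)
        e.symm.continuous.continuousAt (hId (e.symm (L * t))) (inv_pos.2 (hDpos _)).ne'
        (Eventually.of_forall hright)
      simpa using this
    have h2 : HasDerivAt (fun t => L * t) L t := by simpa using (hasDerivAt_id t).const_mul L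
    rw [mul_comm]
    exact h1.comp t h2
  · refine hImono.injective ?_
    rw [hperI, hright, hright]
    ring

lemma exists_int_of_eq_of_angle_param {p : ℝ → ℝ × ℝ} (hp : Function.Periodic p (2 * π)) {ρ : ℝ → ℝ}
    (hρ : ∀ t, 0 < ρ t) (hpd : ∀ t, HasDerivAt p (ρ t * cos t, ρ t * sin t) t) {x y : ℝ}
    (hxy : p x = p y) : ∃ n : ℤ, x = y + n * (2 * π) := by
  have hshort : ∀ a b, a < b → b - a ≤ π → p a ≠ p b := by
    intro a b hab hlen heq
    set m := (a + b) / 2 with hm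
    have hd : ∀ t, HasDerivAt (fun t => (p t).1 * cos m + (p t).2 * sin m) (ρ t * cos (t - m)) t :=
      fun t => (((hpd t).fst'.mul_const (cos m)).add ((hpd t).snd'.mul_const (sin m))).congr_deriv
        (by rw [cos_sub]; ring)
    have hmono := strictMonoOn_of_deriv_pos (convex_Icc a b)
      (f := fun t => (p t).1 * cos m + (p t).2 * sin m)
      (fun t _ => (hd t).continuousAt.continuousWithinAt) (fun t ht => by
        rw [interior_Icc] at ht
        rw [(hd t).deriv]
        exact mul_pos (hρ t) (cos_pos_of_mem_Ioo ⟨by linarith [ht.1], by linarith [ht.2]⟩))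
    have := hmono (Set.left_mem_Icc.2 hab.le) (Set.right_mem_Icc.2 hab.le) hab
    simp only [heq, lt_self_iff_false] at this
  have hlong : ∀ a b, a < b → b < a + 2 * π → p a ≠ p b := by
    intro a b hab hba
    rcases le_or_gt (b - a) π with h | h
    · exact hshort a b hab h
    · rw [← hp a]
      exact (hshort b (a + 2 * π) hba (by linarith)).symm
  obtain ⟨n, hn, -⟩ := existsUnique_add_zsmul_mem_Ico (by positivity : (0 : ℝ) < 2 * π) x y
  have hpn : p (x + n • (2 * π)) = p x := hp.zsmul n x
  refine ⟨-n, ?_⟩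
  rcases hn.1.eq_or_lt with h | h
  · rw [h]; simp
  · exact absurd (hxy.symm.trans hpn.symm) (hlong _ _ h hn.2)

/-- Curves parametrized by the tangent angle become loops after reparametrization. -/
theorem isKLoop_reparam {B : ℝ × ℝ → ℝ} {p : ℝ → ℝ × ℝ} {D ϑ : ℝ → ℝ} {L : ℝ}
    (hp : Function.Periodic p (2 * π)) (hpos : ∀ t, 0 < (p t).2) (hD : Continuous D)
    (hDpos : ∀ t, 0 < D t) (hDB : ∀ t, D t = B (p t) - cos t)
    (hpd : ∀ t, HasDerivAt p ((p t).2 / D t * cos t, (p t).2 / D t * sin t) t) (hL : 0 < L)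
    (hϑ : ∀ t, HasDerivAt ϑ (L * D (ϑ t)) t) (hϑp : ∀ t, ϑ (t + 2 * π) = ϑ t + 2 * π) :
    IsKLoop B (fun t => p (ϑ t)) ∧ IsEmbedded (fun t => p (ϑ t)) ∧
    (∀ t, deriv (fun t => p (ϑ t)) t
      = (L * (p (ϑ t)).2 * cos (ϑ t), L * (p (ϑ t)).2 * sin (ϑ t))) ∧
    (∀ t, deriv (deriv (fun t => p (ϑ t))) t
      = (L ^ 2 * (p (ϑ t)).2 * (sin (ϑ t) * cos (ϑ t) - D (ϑ t) * sin (ϑ t)),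
        L ^ 2 * (p (ϑ t)).2 * (sin (ϑ t) ^ 2 + D (ϑ t) * cos (ϑ t)))) := by
  set u : ℝ → ℝ × ℝ := fun t => p (ϑ t) with hu
  have hϑc : Continuous ϑ := continuous_iff_continuousAt.2 fun t => (hϑ t).continuousAt
  have hpc : Continuous p := continuous_iff_continuousAt.2 fun t => (hpd t).continuousAt
  have hud : ∀ t, HasDerivAt u (L * (u t).2 * cos (ϑ t), L * (u t).2 * sin (ϑ t)) t := by
    intro t
    refine ((hpd (ϑ t)).scomp t (hϑ t)).congr_deriv ?_
    have := (hDpos (ϑ t)).ne'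
    simp only [hu, Prod.smul_mk, smul_eq_mul, Prod.mk.injEq]
    constructor <;> field_simp
  have hud2 : ∀ t, HasDerivAt (fun t => (L * (u t).2 * cos (ϑ t), L * (u t).2 * sin (ϑ t)))
      (L ^ 2 * (u t).2 * (sin (ϑ t) * cos (ϑ t) - D (ϑ t) * sin (ϑ t)),
        L ^ 2 * (u t).2 * (sin (ϑ t) ^ 2 + D (ϑ t) * cos (ϑ t))) t := fun t =>
    HasDerivAt.prodMk
      ((((hud t).snd'.const_mul L).mul (hϑ t).cos).congr_deriv (by ring))
      ((((hud t).snd'.const_mul L).mul (hϑ t).sin).congr_deriv (by ring))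
  have hde : deriv u = fun t => (L * (u t).2 * cos (ϑ t), L * (u t).2 * sin (ϑ t)) :=
    funext fun t => (hud t).deriv
  have hdde : deriv (deriv u) = fun t =>
      (L ^ 2 * (u t).2 * (sin (ϑ t) * cos (ϑ t) - D (ϑ t) * sin (ϑ t)),
        L ^ 2 * (u t).2 * (sin (ϑ t) ^ 2 + D (ϑ t) * cos (ϑ t))) := by
    rw [hde]; exact funext fun t => (hud2 t).deriv
  have huc : Continuous u := hpc.comp hϑc
  have hup : ∀ t, 0 < (u t).2 := fun t => hpos _
  have hlen : hypL u = L := by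
    have e : ∀ t, ((deriv u t).1 ^ 2 + (deriv u t).2 ^ 2) / (u t).2 ^ 2 = L ^ 2 := by
      intro t
      rw [hde]
      have := (hup t).ne'
      have h2 := sin_sq_add_cos_sq (ϑ t)
      simp only
      rw [div_eq_iff (by positivity)]
      linear_combination (L * (u t).2) ^ 2 * h2
    simp only [hypL, e, intervalIntegral.integral_const, sub_zero, smul_eq_mul]
    rw [← mul_assoc, one_div, inv_mul_cancel₀ (by positivity), one_mul, Real.sqrt_sq hL.le]
  refine ⟨⟨?_, fun t => ?_, hup, ?_, fun t => ?_⟩, fun t s hts => ?_, fun t => (hud t).deriv,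
    fun t => congrFun hdde t⟩
  · have h2 : ContDiff ℝ (1 + 1) u := by
      rw [contDiff_succ_iff_deriv]
      refine ⟨fun t => (hud t).differentiableAt, by simp, ?_⟩
      rw [contDiff_one_iff_deriv, hdde, hde]
      exact ⟨fun t => (hud2 t).differentiableAt, by fun_prop⟩
    simpa [one_add_one_eq_two] using h2
  · simp only [hu, hϑp, hp (ϑ t)]
  · rintro ⟨c, hc⟩
    have h0 : deriv u 0 = 0 := by
      have : u = fun _ => c := funext hc
      rw [this, deriv_const]
    rw [hde, Prod.ext_iff] at h0
    have h1 := mul_pos hL (hup 0)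
    have h2 := sin_sq_add_cos_sq (ϑ 0)
    have hc0 : cos (ϑ 0) = 0 := (mul_eq_zero.1 h0.1).resolve_left h1.ne'
    have hs0 : sin (ϑ 0) = 0 := (mul_eq_zero.1 h0.2).resolve_left h1.ne'
    rw [hc0, hs0] at h2
    norm_num at h2
  · rw [hlen, hdde, hde]
    have h1 := (hup t).ne'
    have h2 := sin_sq_add_cos_sq (ϑ t)
    have h3 : D (ϑ t) = B (u t) - cos (ϑ t) := hDB _
    simp only [Gam, rot, h3, Prod.smul_mk, Prod.mk_sub_mk, smul_eq_mul, Prod.mk.injEq]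
    constructor
    · field_simp; ring
    · field_simp; ring
  · obtain ⟨n, hn⟩ := exists_int_of_eq_of_angle_param hp (fun t => div_pos (hpos t) (hDpos t)) hpd hts
    have hinj : StrictMono ϑ := strictMono_of_deriv_pos fun x => by
      rw [(hϑ x).deriv]; exact mul_pos hL (hDpos _)
    have hshift : ϑ (s + n * (2 * π)) = ϑ s + n * (2 * π) := by
      have hper : Function.Periodic (fun t => ϑ t - t) (2 * π) := fun t => by
        simp only [hϑp]; ring
      have : ϑ (s + n * (2 * π)) - (s + n * (2 * π)) = ϑ s - s := hper.int_mul n s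
      linarith
    exact ⟨n, by rw [hinj.injective (hn.trans hshift.symm)]; ring⟩

lemma one_add_mul_eq_div {k R ε θ K κ : ℝ} {a : ℝ × ℝ} (hkc : 0 < k - cos θ)
    (hκ : κ * (R * a.2 * (k - cos θ)) ^ 2 = K) :
    1 + ε * (κ * (k - cos θ) * (R * a.2) ^ 2) = (k + ε * K - cos θ) / (k - cos θ) := by
  rw [← hκ, eq_div_iff hkc.ne']
  ring

/-- A curve whose moving center solves the reduced equation has the prescribed curvature. -/
lemma hasDerivAt_circPt_of_center {k R ε : ℝ} {K κ : ℝ × ℝ → ℝ} {q : ℝ → ℝ × ℝ}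
    {t : ℝ} (hkc : 0 < k - cos t)
    (hκ : κ (circPt k R t (q t)) * (circPt k R t (q t)).2 ^ 2 = K (circPt k R t (q t)))
    (hD : 0 < k + ε * K (circPt k R t (q t)) - cos t)
    (hq : HasDerivAt q (ε • (normFactor k R κ ε t (q t) • forcing k R κ t (q t))) t) :
    HasDerivAt (fun s => circPt k R s (q s))
      ((circPt k R t (q t)).2 / (k + ε * K (circPt k R t (q t)) - cos t) * cos t,
        (circPt k R t (q t)).2 / (k + ε * K (circPt k R t (q t)) - cos t) * sin t) t := by
  refine (hasDerivAt_circPt (k := k) (R := R) hq (hasDerivAt_id t)).congr_deriv ?_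
  set P := circPt k R t (q t) with hP
  have hP2 : P.2 = R * (q t).2 * (k - cos t) := rfl
  have hJ : normFactor k R κ ε t (q t)
      = (R * (q t).2) ^ 2 * (k - cos t) / (k + ε * K P - cos t) := by
    rw [normFactor, one_add_mul_eq_div hkc (K := K P) (by rw [← hP2]; exact hκ)]
    field_simp
  have hs : sin t ^ 2 = 1 - cos t ^ 2 := by rw [← sin_sq_add_cos_sq t]; ring
  have hJκ : ε * normFactor k R κ ε t (q t) * κ P * (k - cos t) * (k + ε * K P - cos t)
      = ε * K P := by
    rw [hJ, div_eq_mul_inv]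
    rw [hP2] at hκ
    have hinv := inv_mul_cancel₀ hD.ne'
    linear_combination ε * hκ + ε * κ P * (R * (q t).2 * (k - cos t)) ^ 2 * hinv
  simp only [forcing, ← hP, id, Prod.smul_mk, smul_eq_mul, mul_one, Prod.mk.injEq, hP2]
  set D := k + ε * K P - cos t with hDdef
  have hKD : ε * K P = D - (k - cos t) := by rw [hDdef]; ring
  rw [hKD] at hJκ
  set j := ε * normFactor k R κ ε t (q t) * κ P with hj
  have e1 : ∀ x, ε * (normFactor k R κ ε t (q t) * (-(κ P * (q t).2) * x)) = -(j * (q t).2 * x) :=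
    fun x => by rw [hj]; ring
  simp only [e1]
  have hjD : j * (k - cos t) = (D - (k - cos t)) / D := by
    rw [eq_div_iff hD.ne']; linear_combination hJκ
  have hdiv : R * (q t).2 * (k - cos t) / D = R * (q t).2 * (1 - j * (k - cos t)) := by
    rw [hjD]; field_simp; ring
  rw [hdiv]
  constructor
  · linear_combination -(R * (q t).2 * j) * hs
  · ring

lemma Rk_pos {k : ℝ} (hk : 1 < k) : 0 < Rk k := by
  unfold Rk
  have : 0 < k ^ 2 - 1 := by nlinarith
  positivity

lemma Rk_sq_mul {k : ℝ} (hk : 1 < k) : Rk k ^ 2 * (k ^ 2 - 1) = 1 := by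
  have : 0 < k ^ 2 - 1 := by nlinarith
  rw [Rk, div_pow, Real.sq_sqrt this.le]
  field_simp

lemma sub_cos_pos {k : ℝ} (hk : 1 < k) (t : ℝ) : 0 < k - cos t := by linarith [cos_le_one t]

lemma sub_sin_pos {k : ℝ} (hk : 1 < k) (t : ℝ) : 0 < k - sin t := by linarith [sin_le_one t]

/-- The tangent angle along the reference circle. -/
def circAngle (k t : ℝ) : ℝ := ∫ s in (-(π / 2))..t, (Rk k * (k - sin s))⁻¹

lemma continuous_inv_sub_sin {k : ℝ} (hk : 1 < k) :
    Continuous fun s => (Rk k * (k - sin s))⁻¹ :=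
  Continuous.inv₀ (by fun_prop) fun s => (mul_pos (Rk_pos hk) (sub_sin_pos hk s)).ne'

lemma hasDerivAt_circAngle {k : ℝ} (hk : 1 < k) (t : ℝ) :
    HasDerivAt (circAngle k) (Rk k * (k - sin t))⁻¹ t :=
  have hc := continuous_inv_sub_sin hk
  intervalIntegral.integral_hasDerivAt_right (hc.intervalIntegrable _ _)
    (hc.stronglyMeasurableAtFilter _ _) hc.continuousAt

lemma cos_sin_circAngle {k : ℝ} (hk : 1 < k) (t : ℝ) :
    cos (circAngle k t) = (1 - k * sin t) / (k - sin t) ∧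
    sin (circAngle k t) = cos t / (Rk k * (k - sin t)) := by
  set a : ℝ → ℝ := fun t => (1 - k * sin t) / (k - sin t) with ha
  set b : ℝ → ℝ := fun t => cos t / (Rk k * (k - sin t)) with hb
  set φ : ℝ → ℝ := circAngle k with hφ
  have hR := Rk_pos hk
  have hR2 := Rk_sq_mul hk
  have hφd : ∀ t, HasDerivAt φ (Rk k * (k - sin t))⁻¹ t := hasDerivAt_circAngle hk
  have had : ∀ t, HasDerivAt a (-(b t * (Rk k * (k - sin t))⁻¹)) t := by
    intro t
    have h0 := (sub_sin_pos hk t).ne'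
    refine ((((hasDerivAt_sin t).const_mul k).const_sub 1).div ((hasDerivAt_sin t).const_sub k)
      h0).congr_deriv ?_
    simp only [hb]
    field_simp
    linear_combination -cos t * hR2
  have hbd : ∀ t, HasDerivAt b (a t * (Rk k * (k - sin t))⁻¹) t := by
    intro t
    have h0 := (sub_sin_pos hk t).ne'
    refine ((hasDerivAt_cos t).div (((hasDerivAt_sin t).const_sub k).const_mul (Rk k))
      (mul_ne_zero hR.ne' h0)).congr_deriv ?_
    simp only [ha]
    field_simp
    linear_combination sin_sq_add_cos_sq t
  have hX : ∀ t, HasDerivAt (fun t => a t * cos (φ t) + b t * sin (φ t)) 0 t := fun t =>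
    (((had t).mul (hφd t).cos).add ((hbd t).mul (hφd t).sin)).congr_deriv (by ring)
  have hY : ∀ t, HasDerivAt (fun t => b t * cos (φ t) - a t * sin (φ t)) 0 t := fun t =>
    (((hbd t).mul (hφd t).cos).sub ((had t).mul (hφd t).sin)).congr_deriv (by ring)
  have h0 : φ (-(π / 2)) = 0 := by simp [hφ, circAngle]
  have ha0 : a (-(π / 2)) = 1 := by
    simp only [ha, sin_neg, sin_pi_div_two]
    rw [div_eq_one_iff_eq (by linarith)]
    ring
  have hb0 : b (-(π / 2)) = 0 := by simp [hb]
  have hX1 : a t * cos (φ t) + b t * sin (φ t) = 1 := by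
    have := is_const_of_deriv_eq_zero (fun t => (hX t).differentiableAt) (fun t => (hX t).deriv) t
      (-(π / 2))
    rw [this, h0, ha0, hb0]; simp
  have hY1 : b t * cos (φ t) - a t * sin (φ t) = 0 := by
    have := is_const_of_deriv_eq_zero (fun t => (hY t).differentiableAt) (fun t => (hY t).deriv) t
      (-(π / 2))
    rw [this, h0, ha0, hb0]; simp
  have hsc := sin_sq_add_cos_sq (φ t)
  change cos (φ t) = a t ∧ sin (φ t) = b t
  constructor
  · linear_combination a t * hsc - cos (φ t) * hX1 + sin (φ t) * hY1
  · linear_combination b t * hsc - sin (φ t) * hX1 - cos (φ t) * hY1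

lemma omz_eq_circPt {k : ℝ} (hk : 1 < k) (z : ℝ × ℝ) (t : ℝ) :
    omz k z t = circPt k (Rk k) (circAngle k t) z := by
  obtain ⟨h1, h2⟩ := cos_sin_circAngle hk t
  have hR := Rk_pos hk
  have hR2 := Rk_sq_mul hk
  have h0 := sub_sin_pos hk t
  simp only [omz, om, circPt, h1, h2, Prod.mk.injEq]
  constructor
  · field_simp
  · field_simp
    linear_combination -z.2 * hR2

lemma hasDerivAt_circAngle_cos {k : ℝ} (hk : 1 < k) (t : ℝ) :
    HasDerivAt (circAngle k) (Rk k * (k - cos (circAngle k t))) t := by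
  refine (hasDerivAt_circAngle hk t).congr_deriv ?_
  have hR := Rk_pos hk
  have hR2 := Rk_sq_mul hk
  have h0 := sub_sin_pos hk t
  rw [(cos_sin_circAngle hk t).1]
  field_simp
  linear_combination -hR2

lemma continuous_inv_sub_cos {k : ℝ} (hk : 1 < k) : Continuous fun s => (k - cos s)⁻¹ :=
  Continuous.inv₀ (by fun_prop) fun s => (sub_cos_pos hk s).ne'

lemma integral_circAngle {k : ℝ} (hk : 1 < k) (t : ℝ) :
    ∫ s in (0 : ℝ)..circAngle k t, (k - cos s)⁻¹ = Rk k * (t + π / 2) := by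
  have hc := continuous_inv_sub_cos hk
  have hI : ∀ x, HasDerivAt (fun x => ∫ s in (0 : ℝ)..x, (k - cos s)⁻¹) (k - cos x)⁻¹ x := fun x =>
    intervalIntegral.integral_hasDerivAt_right (hc.intervalIntegrable _ _)
      (hc.stronglyMeasurableAtFilter _ _) hc.continuousAt
  have hd : ∀ t, HasDerivAt
      (fun t => (∫ s in (0 : ℝ)..circAngle k t, (k - cos s)⁻¹) - Rk k * t) 0 t := fun t =>
    (((hI (circAngle k t)).comp t (hasDerivAt_circAngle_cos hk t)).sub
      ((hasDerivAt_id t).const_mul (Rk k))).congr_deriv (by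
        have := (sub_cos_pos hk (circAngle k t)).ne'
        field_simp; ring)
  have := is_const_of_deriv_eq_zero (fun t => (hd t).differentiableAt) (fun t => (hd t).deriv) t
    (-(π / 2))
  have h0 : circAngle k (-(π / 2)) = 0 := by simp [circAngle]
  rw [h0, intervalIntegral.integral_same] at this
  linarith

lemma circAngle_add_two_pi_aux {k : ℝ} (hk : 1 < k) (t : ℝ) :
    circAngle k (t + 2 * π)
      = circAngle k t + (Rk k)⁻¹ * ∫ s in (0 : ℝ)..(2 * π), (k - cos s)⁻¹ := by
  have hc := continuous_inv_sub_sin hk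
  have hp : Function.Periodic (fun s => (Rk k * (k - sin s))⁻¹) (2 * π) := fun s => by simp
  have hp' : Function.Periodic (fun s => (k - cos s)⁻¹) (2 * π) := fun s => by simp
  have h1 := intervalIntegral.integral_add_adjacent_intervals
    (hc.intervalIntegrable (μ := volume) (-(π / 2)) t) (hc.intervalIntegrable t (t + 2 * π))
  rw [hp.intervalIntegral_add_eq t (π / 2)] at h1
  have h2 : ∫ s in (π / 2)..(π / 2 + 2 * π), (Rk k * (k - sin s))⁻¹
      = ∫ s in (0 : ℝ)..(2 * π), (Rk k)⁻¹ * (k - cos s)⁻¹ := by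
    have e : ∀ s : ℝ, (Rk k)⁻¹ * (k - cos s)⁻¹ = (Rk k * (k - sin (π / 2 - s)))⁻¹ := fun s => by
      rw [sin_pi_div_two_sub, mul_inv]
    simp_rw [e]
    rw [intervalIntegral.integral_comp_sub_left (fun s => (Rk k * (k - sin s))⁻¹) (π / 2)]
    have := hp.intervalIntegral_add_eq (π / 2) (π / 2 - 2 * π)
    rw [this]
    congr 1; ring
  rw [h2, intervalIntegral.integral_const_mul] at h1
  exact h1.symm

lemma integral_inv_sub_cos {k : ℝ} (hk : 1 < k) :
    ∫ s in (0 : ℝ)..(2 * π), (k - cos s)⁻¹ = 2 * π * Rk k := by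
  have hR := Rk_pos hk
  set T := ∫ s in (0 : ℝ)..(2 * π), (k - cos s)⁻¹ with hT
  have hTpos : 0 < T := by
    refine intervalIntegral.intervalIntegral_pos_of_pos
      ((continuous_inv_sub_cos hk).intervalIntegrable _ _) (fun s => inv_pos.2 (sub_cos_pos hk s))
      (by positivity)
  have h0 : circAngle k (-(π / 2)) = 0 := by simp [circAngle]
  have h1 := circAngle_add_two_pi_aux hk (-(π / 2))
  rw [h0, zero_add, ← hT] at h1
  have hcos : cos ((Rk k)⁻¹ * T) = 1 := by
    rw [← h1, (cos_sin_circAngle hk _).1, sin_add_two_pi, sin_neg, sin_pi_div_two,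
      div_eq_one_iff_eq (by linarith)]
    ring
  obtain ⟨n, hn⟩ := (Real.cos_eq_one_iff _).1 hcos
  have h2 := integral_circAngle hk (-(π / 2) + 2 * π)
  have hp' : Function.Periodic (fun s => (k - cos s)⁻¹) (2 * π) := fun s => by simp
  have h3 := hp'.intervalIntegral_add_zsmul_eq n 0
    (fun a b => (continuous_inv_sub_cos hk).intervalIntegrable a b)
  rw [zero_add, zero_add, ← hT, zsmul_eq_mul, zsmul_eq_mul, hn, ← h1, h2] at h3
  have h4 : T = n * (2 * π) * Rk k := by
    rw [hn]; field_simp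
  have h5 : (n : ℝ) * n = 1 := by
    have : (2 * π * Rk k) * ((n : ℝ) * n) = (2 * π * Rk k) * 1 := by
      rw [h4] at h3; linarith
    exact mul_left_cancel₀ (by positivity) this
  have hn0 : (0 : ℝ) < n := by
    have : 0 < (n : ℝ) * (2 * π) := by rw [hn]; positivity
    exact pos_of_mul_pos_left this (by positivity)
  have hn1 : (n : ℝ) = 1 := by nlinarith
  rw [h4, hn1]; ring

lemma circAngle_add_two_pi {k : ℝ} (hk : 1 < k) (t : ℝ) :
    circAngle k (t + 2 * π) = circAngle k t + 2 * π := by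
  rw [circAngle_add_two_pi_aux hk, integral_inv_sub_cos hk]
  have := Rk_pos hk
  field_simp

lemma mul_abs_sub_le_abs_integral {f : ℝ → ℝ} (hf : Continuous f) {m : ℝ} (hm : ∀ t, m ≤ f t)
    (a b : ℝ) : m * |b - a| ≤ |∫ s in a..b, f s| := by
  have key : ∀ a b : ℝ, a ≤ b → m * (b - a) ≤ ∫ s in a..b, f s := fun a b hab => by
    have := intervalIntegral.integral_mono_on hab (intervalIntegrable_const (c := m))
      (hf.intervalIntegrable (μ := volume) a b) fun s _ => hm s
    rwa [intervalIntegral.integral_const, smul_eq_mul, mul_comm] at this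
  rcases le_total a b with h | h
  · rw [abs_of_nonneg (sub_nonneg.2 h)]
    exact (key a b h).trans (le_abs_self _)
  · rw [abs_sub_comm, abs_of_nonneg (sub_nonneg.2 h), intervalIntegral.integral_symm, abs_neg]
    exact (key b a h).trans (le_abs_self _)

lemma abs_inv_sub_inv_le {x y c η : ℝ} (hc : 0 < c) (hx : c ≤ x) (hy : c ≤ y)
    (h : |x - y| ≤ η) : |x⁻¹ - y⁻¹| ≤ η / c ^ 2 := by
  have hx0 := hc.trans_le hx
  have hy0 := hc.trans_le hy
  rw [inv_sub_inv hx0.ne' hy0.ne', abs_div, abs_of_pos (mul_pos hx0 hy0), abs_sub_comm]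
  have : c ^ 2 ≤ x * y := by nlinarith
  exact div_le_div₀ ((abs_nonneg _).trans h) h (by positivity) this

lemma circAngle_mem_Icc {k : ℝ} (hk : 1 < k) {t : ℝ} (h0 : 0 ≤ t + π / 2)
    (h1 : t + π / 2 ≤ 2 * π) : 0 ≤ circAngle k t ∧ circAngle k t ≤ 2 * π := by
  have hmono : Monotone (circAngle k) := monotone_of_deriv_nonneg
    (fun t => (hasDerivAt_circAngle hk t).differentiableAt) fun t => by
      rw [(hasDerivAt_circAngle hk t).deriv]
      exact inv_nonneg.2 (mul_pos (Rk_pos hk) (sub_sin_pos hk t)).le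
  have e0 : circAngle k (-(π / 2)) = 0 := by simp [circAngle]
  have e1 := circAngle_add_two_pi hk (-(π / 2))
  rw [e0, zero_add] at e1
  exact ⟨e0 ▸ hmono (by linarith), e1 ▸ hmono (by linarith)⟩

/-- The arc-length factor and the tangent angle depend continuously on the density `D`. -/
lemma abs_sub_circAngle_le {k : ℝ} (hk : 1 < k) {D ϑ : ℝ → ℝ} {L c C η : ℝ} (hD : Continuous D)
    (hc : 0 < c) (hcD : ∀ t, c ≤ D t) (hDC : ∀ t, D t ≤ C) (hck : c ≤ k - 1)
    (hη : ∀ t, |D t - (k - cos t)| ≤ η)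
    (hL : L = (2 * π)⁻¹ * ∫ t in (0 : ℝ)..(2 * π), (D t)⁻¹)
    (hϑp : ∀ t, ϑ (t + 2 * π) = ϑ t + 2 * π)
    (hϑI : ∀ t, ∫ s in (0 : ℝ)..ϑ t, (D s)⁻¹ = L * t) :
    |L - Rk k| ≤ η / c ^ 2 ∧
      ∀ t, |ϑ (t + π / 2) - circAngle k t| ≤ C * (4 * π * (η / c ^ 2)) := by
  have hC : 0 < C := hc.trans_le ((hcD 0).trans (hDC 0))
  have hDi : Continuous fun s => (D s)⁻¹ := hD.inv₀ fun s => (hc.trans_le (hcD s)).ne'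
  have hki := continuous_inv_sub_cos hk
  have hpt : ∀ s, ‖(D s)⁻¹ - (k - cos s)⁻¹‖ ≤ η / c ^ 2 := fun s =>
    abs_inv_sub_inv_le hc (hcD s) (by linarith [cos_le_one s]) (hη s)
  have hLR : |L - Rk k| ≤ η / c ^ 2 := by
    have h1 : L - Rk k = (2 * π)⁻¹ * ∫ s in (0 : ℝ)..(2 * π), ((D s)⁻¹ - (k - cos s)⁻¹) := by
      rw [intervalIntegral.integral_sub (hDi.intervalIntegrable _ _) (hki.intervalIntegrable _ _),
        integral_inv_sub_cos hk, hL]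
      field_simp
    have h2 := norm_integral_two_pi_le hpt
    rw [h1, abs_mul, abs_of_pos (by positivity : (0 : ℝ) < (2 * π)⁻¹), inv_mul_le_iff₀ (by positivity)]
    exact h2
  refine ⟨hLR, fun t => ?_⟩
  have hper : Function.Periodic (fun t => ϑ (t + π / 2) - circAngle k t) (2 * π) := fun t => by
    simp only
    rw [circAngle_add_two_pi hk, show t + 2 * π + π / 2 = t + π / 2 + 2 * π by ring, hϑp]
    ring
  obtain ⟨s, hs, hst⟩ := hper.exists_mem_Ico (by positivity : (0 : ℝ) < 2 * π) t (-(π / 2))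
  rw [hst]
  have h0 : 0 ≤ s + π / 2 := by linarith [hs.1]
  have h1 : s + π / 2 ≤ 2 * π := by linarith [hs.2]
  obtain ⟨ha0, ha1⟩ := circAngle_mem_Icc hk h0 h1
  set φ := circAngle k s with hφ
  have e1 : ∫ x in φ..ϑ (s + π / 2), (D x)⁻¹
      = (L - Rk k) * (s + π / 2) - ∫ x in (0 : ℝ)..φ, ((D x)⁻¹ - (k - cos x)⁻¹) := by
    rw [intervalIntegral.integral_sub (hDi.intervalIntegrable _ _) (hki.intervalIntegrable _ _),
      hφ, integral_circAngle hk, ← hφ,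
      ← intervalIntegral.integral_interval_sub_left (hDi.intervalIntegrable 0 _)
        (hDi.intervalIntegrable 0 _), hϑI]
    ring
  have e2 : |∫ x in (0 : ℝ)..φ, ((D x)⁻¹ - (k - cos x)⁻¹)| ≤ η / c ^ 2 * (2 * π) := by
    refine (intervalIntegral.norm_integral_le_of_norm_le_const fun x _ => hpt x).trans ?_
    rw [sub_zero, abs_of_nonneg ha0]
    exact mul_le_mul_of_nonneg_left ha1 ((norm_nonneg _).trans (hpt 0))
  have e3 : |(L - Rk k) * (s + π / 2)| ≤ η / c ^ 2 * (2 * π) := by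
    rw [abs_mul, abs_of_nonneg h0]
    exact mul_le_mul hLR h1 h0 ((norm_nonneg _).trans (hpt 0))
  have e4 := mul_abs_sub_le_abs_integral hDi
    (fun x => inv_anti₀ (hc.trans_le (hcD x)) (hDC x)) φ (ϑ (s + π / 2))
  rw [inv_mul_le_iff₀ hC] at e4
  refine e4.trans (mul_le_mul_of_nonneg_left ?_ hC.le)
  rw [e1]
  exact (abs_sub _ _).trans (by linarith)

/-- The position, velocity and acceleration of a loop in terms of its speed factor, tangent
angle, moving center and density. -/
def angleJet (k : ℝ) (x : ℝ × ℝ × (ℝ × ℝ) × ℝ) : (ℝ × ℝ) × (ℝ × ℝ) × (ℝ × ℝ) :=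
  (circPt k (Rk k) x.2.1 x.2.2.1,
    (x.1 * (circPt k (Rk k) x.2.1 x.2.2.1).2 * cos x.2.1,
      x.1 * (circPt k (Rk k) x.2.1 x.2.2.1).2 * sin x.2.1),
    (x.1 ^ 2 * (circPt k (Rk k) x.2.1 x.2.2.1).2 * (sin x.2.1 * cos x.2.1 - x.2.2.2 * sin x.2.1),
      x.1 ^ 2 * (circPt k (Rk k) x.2.1 x.2.2.1).2 * (sin x.2.1 ^ 2 + x.2.2.2 * cos x.2.1)))

lemma continuous_angleJet (k : ℝ) : Continuous (angleJet k) := by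
  unfold angleJet circPt
  fun_prop

lemma angleJet_add_int_mul_two_pi (k L φ : ℝ) (a : ℝ × ℝ) (D : ℝ) (n : ℤ) :
    angleJet k (L, φ + n * (2 * π), a, D) = angleJet k (L, φ, a, D) := by
  simp [angleJet, circPt]

lemma exists_dist_angleJet_lt (k : ℝ) (z₀ : ℝ × ℝ) {δ : ℝ} (hδ : 0 < δ) :
    ∃ η > 0, ∀ (L φ φ₀ : ℝ) (a : ℝ × ℝ) (D : ℝ), |L - Rk k| < η → |φ - φ₀| < η → ‖a - z₀‖ < η →
      |D - (k - cos φ₀)| < η →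
      dist (angleJet k (L, φ, a, D)) (angleJet k (Rk k, φ₀, z₀, k - cos φ₀)) < δ := by
  have hS : IsCompact (({Rk k} : Set ℝ) ×ˢ Set.Icc (0 : ℝ) (2 * π) ×ˢ ({z₀} : Set (ℝ × ℝ)) ×ˢ
      Set.Icc (k - 1) (k + 1)) :=
    isCompact_singleton.prod (isCompact_Icc.prod (isCompact_singleton.prod isCompact_Icc))
  have := hS.uniformContinuousAt_of_continuousAt (angleJet k)
    (fun _ _ => (continuous_angleJet k).continuousAt) (Metric.dist_mem_uniformity hδ)
  obtain ⟨η, hη, h⟩ := Metric.mem_uniformity_dist.1 this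
  refine ⟨η, hη, fun L φ φ₀ a D hL hφ ha hD => ?_⟩
  obtain ⟨y, hy, n, hn⟩ : ∃ y ∈ Set.Icc (0 : ℝ) (2 * π), ∃ n : ℤ, y = φ₀ + n * (2 * π) := by
    have h2 : (0 : ℝ) < 2 * π := by positivity
    refine ⟨toIcoMod h2 0 φ₀, ?_, -toIcoDiv h2 0 φ₀, ?_⟩
    · have := toIcoMod_mem_Ico h2 0 φ₀
      rw [zero_add] at this
      exact ⟨this.1, this.2.le⟩
    · rw [toIcoMod, zsmul_eq_mul]; push_cast; ring
  rw [← angleJet_add_int_mul_two_pi k L φ a D n,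
    ← angleJet_add_int_mul_two_pi k (Rk k) φ₀ z₀ (k - cos φ₀) n, ← hn, dist_comm]
  refine h (a := (Rk k, y, z₀, k - cos φ₀)) (b := (L, φ + n * (2 * π), a, D)) ?_ ?_
  · refine max_lt ?_ (max_lt ?_ (max_lt ?_ ?_))
    · rwa [dist_comm, Real.dist_eq]
    · rw [hn, dist_comm, Real.dist_eq]; simpa using hφ
    · rwa [dist_comm, dist_eq_norm]
    · rwa [dist_comm, Real.dist_eq]
  · exact ⟨rfl, hy, rfl, by linarith [cos_le_one φ₀], by linarith [neg_one_le_cos φ₀]⟩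

lemma enorm2_le (w : ℝ × ℝ) : enorm2 w ≤ 2 * ‖w‖ := by
  refine Real.sqrt_le_iff.2 ⟨by positivity, ?_⟩
  have h1 : w.1 ^ 2 ≤ ‖w‖ ^ 2 := by
    rw [← sq_abs]; exact pow_le_pow_left₀ (abs_nonneg _) (norm_fst_le w) 2
  have h2 : w.2 ^ 2 ≤ ‖w‖ ^ 2 := by
    rw [← sq_abs]; exact pow_le_pow_left₀ (abs_nonneg _) (norm_snd_le w) 2
  nlinarith [sq_nonneg ‖w‖]

lemma enorm2_add_lt_of_dist_lt {a b c a' b' c' : ℝ × ℝ} {δ : ℝ}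
    (h : dist (a, b, c) (a', b', c') < δ / 6) :
    enorm2 (a - a') + enorm2 (b - b') + enorm2 (c - c') < δ := by
  simp only [dist_eq_norm, Prod.mk_sub_mk] at h
  have h1 := (norm_fst_le (a - a', b - b', c - c')).trans_lt h
  have h2 := (norm_snd_le (a - a', b - b', c - c')).trans_lt h
  have h3 := (norm_fst_le (b - b', c - c')).trans_lt h2
  have h4 := (norm_snd_le (b - b', c - c')).trans_lt h2
  simp only at h1 h3 h4
  linarith [enorm2_le (a - a'), enorm2_le (b - b'), enorm2_le (c - c')]

lemma jet_omz {k : ℝ} (hk : 1 < k) {z : ℝ × ℝ} (hz : 0 < z.2) (t : ℝ) :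
    (omz k z t, deriv (omz k z) t, deriv (deriv (omz k z)) t)
      = angleJet k (Rk k, circAngle k t, z, k - cos (circAngle k t)) := by
  have hR := Rk_pos hk
  have e : omz k z = fun t => circPt k (Rk k) (circAngle k t) z := funext (omz_eq_circPt hk z)
  obtain ⟨-, -, h1, h2⟩ := isKLoop_reparam (B := fun _ => k) (p := fun t => circPt k (Rk k) t z)
    (D := fun t => k - cos t) (ϑ := circAngle k) (L := Rk k)
    (fun t => circPt_add_two_pi ..) (fun t => mul_pos (mul_pos hR hz) (sub_cos_pos hk t))
    (by fun_prop) (sub_cos_pos hk) (fun _ => rfl)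
    (fun t => by
      have := hasDerivAt_circPt_of_center (k := k) (R := Rk k) (ε := 0) (K := fun _ => 0)
        (κ := fun _ => 0) (q := fun _ => z) (sub_cos_pos hk t) (by simp)
        (by simpa using sub_cos_pos hk t) ((hasDerivAt_const t z).congr_deriv (by simp))
      simpa using this)
    hR (hasDerivAt_circAngle_cos hk) (circAngle_add_two_pi hk)
  rw [e, h1, h2]
  rfl

/-- `u` is given by `angleJet` with data within `η` of those of the reference circle with
center `z`. -/
def HasJetNear (k η : ℝ) (z : ℝ × ℝ) (u : ℝ → ℝ × ℝ) : Prop :=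
  ∃ (L : ℝ) (φ : ℝ → ℝ) (a : ℝ → ℝ × ℝ) (D : ℝ → ℝ),
    (∀ t, (u t, deriv u t, deriv (deriv u) t) = angleJet k (L, φ t, a t, D t)) ∧
    |L - Rk k| ≤ η ∧ (∀ t, |φ t - circAngle k t| ≤ η) ∧ (∀ t, ‖a t - z‖ ≤ η) ∧
    ∀ t, |D t - (k - cos (circAngle k t))| ≤ η

lemma exists_embedded_loop_of_center {k : ℝ} (hk : 1 < k) {M C : ℝ} (hM : 0 ≤ M) (hC : 0 ≤ C) :
    ∃ N : ℝ, 0 ≤ N ∧ ∀ (ε : ℝ) (K κ : ℝ × ℝ → ℝ) (q : ℝ → ℝ × ℝ) (z : ℝ × ℝ), |ε| ≤ 1 →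
      Continuous κ → Function.Periodic q (2 * π) → (∀ t, 0 < (q t).2) →
      (∀ t, κ (circPt k (Rk k) t (q t)) * (circPt k (Rk k) t (q t)).2 ^ 2
        = K (circPt k (Rk k) t (q t))) →
      (∀ t, |K (circPt k (Rk k) t (q t))| ≤ M) →
      (∀ t, 1 / 2 ≤ 1 + ε * (κ (circPt k (Rk k) t (q t)) * (k - cos t) * (Rk k * (q t).2) ^ 2)) →
      (∀ t, HasDerivAt q
        (ε • (normFactor k (Rk k) κ ε t (q t) • forcing k (Rk k) κ t (q t))) t) →
      (∀ t, ‖q t - z‖ ≤ C * |ε|) →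
      ∃ u, IsKLoop (fun z => k + ε * K z) u ∧ IsEmbedded u ∧ HasJetNear k (N * |ε|) z u := by
  have hR := Rk_pos hk
  set c : ℝ := (k - 1) / 2 with hc
  have hc0 : 0 < c := by rw [hc]; linarith
  set N₁ : ℝ := M / c ^ 2 with hN₁
  set N₂ : ℝ := (k + 1 + M) * (4 * π * N₁) with hN₂
  have hN₁0 : 0 ≤ N₁ := by positivity
  have hN₂0 : 0 ≤ N₂ := by positivity
  refine ⟨N₁ + N₂ + M + C, by positivity, fun ε K κ q z hε hκc hqp hqpos hκK hKM hhalf hq hqz => ?_⟩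
  set p : ℝ → ℝ × ℝ := fun t => circPt k (Rk k) t (q t) with hp
  set D : ℝ → ℝ := fun t => k + ε * K (p t) - cos t with hDdef
  have hqc : Continuous q := continuous_iff_continuousAt.2 fun t => (hq t).continuousAt
  have hpc : Continuous p := by
    simp only [hp, circPt]
    fun_prop
  have hDc : Continuous D := by
    have : D = fun t => k + ε * (κ (p t) * (p t).2 ^ 2) - cos t := by
      funext t; simp only [hDdef, hp, hκK]
    rw [this]
    fun_prop
  have hpp : Function.Periodic p (2 * π) := fun t => by
    simp only [hp, hqp t, circPt_add_two_pi]
  have hDp : Function.Periodic D (2 * π) := fun t => by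
    simp only [hDdef, hpp t, cos_add_two_pi]
  have hcD : ∀ t, c ≤ D t := fun t => by
    have h0 := sub_cos_pos hk t
    have h1 := hhalf t
    rw [one_add_mul_eq_div h0 (K := K (p t)) (hκK t), le_div_iff₀ h0] at h1
    simp only [hDdef, hc]
    linarith [cos_le_one t]
  have hDη : ∀ t, |D t - (k - cos t)| ≤ M * |ε| := fun t => by
    have : D t - (k - cos t) = ε * K (p t) := by simp only [hDdef]; ring
    rw [this, abs_mul, mul_comm]
    exact mul_le_mul_of_nonneg_right (hKM t) (abs_nonneg ε)
  have hDC : ∀ t, D t ≤ k + 1 + M := fun t => by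
    have h1 := (abs_le.1 (hDη t)).2
    have h2 : M * |ε| ≤ M := mul_le_of_le_one_right hM hε
    linarith [neg_one_le_cos t]
  obtain ⟨hL, ϑ, hϑ, hϑp, hϑI⟩ := exists_angle_reparam hDc hDp hc0 hcD hDC rfl
  set L := (2 * π)⁻¹ * ∫ t in (0 : ℝ)..(2 * π), (D t)⁻¹ with hLdef
  obtain ⟨hLR, hang⟩ := abs_sub_circAngle_le hk hDc hc0 hcD hDC (by rw [hc]; linarith) hDη hLdef
    hϑp hϑI
  have hdiv : M * |ε| / c ^ 2 = N₁ * |ε| := by rw [hN₁]; ring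
  rw [hdiv] at hLR
  have hang' : ∀ t, |ϑ (t + π / 2) - circAngle k t| ≤ N₂ * |ε| := fun t => by
    refine (hang t).trans (le_of_eq ?_)
    rw [hdiv, hN₂]; ring
  have e0 := abs_nonneg ε
  obtain ⟨h1, h2, h3, h4⟩ := isKLoop_reparam (B := fun z => k + ε * K z) (p := p) (D := D)
    (ϑ := fun t => ϑ (t + π / 2)) (L := L) hpp
    (fun t => mul_pos (mul_pos hR (hqpos t)) (sub_cos_pos hk t)) hDc
    (fun t => hc0.trans_le (hcD t)) (fun _ => rfl)
    (fun t => hasDerivAt_circPt_of_center (sub_cos_pos hk t) (hκK t)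
      (hc0.trans_le (hcD t)) (hq t)) hL (fun t => (hϑ (t + π / 2)).comp_add_const t (π / 2))
    (fun t => by rw [show t + 2 * π + π / 2 = t + π / 2 + 2 * π by ring, hϑp])
  refine ⟨_, h1, h2, L, fun t => ϑ (t + π / 2), fun t => q (ϑ (t + π / 2)),
    fun t => D (ϑ (t + π / 2)), fun t => ?_, ?_, fun t => ?_, fun t => ?_, fun t => ?_⟩
  · rw [h3, h4]; rfl
  · nlinarith [mul_nonneg hN₂0 e0, mul_nonneg hM e0, mul_nonneg hC e0]
  · have := hang' t
    nlinarith [mul_nonneg hN₁0 e0, mul_nonneg hM e0, mul_nonneg hC e0]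
  · have := hqz (ϑ (t + π / 2))
    nlinarith [mul_nonneg hN₁0 e0, mul_nonneg hM e0, mul_nonneg hN₂0 e0]
  · have i1 := hDη (ϑ (t + π / 2))
    have i2 := Real.abs_cos_sub_cos_le (ϑ (t + π / 2)) (circAngle k t)
    have i3 := hang' t
    have i4 : |D (ϑ (t + π / 2)) - (k - cos (circAngle k t))|
        ≤ |D (ϑ (t + π / 2)) - (k - cos (ϑ (t + π / 2)))|
          + |cos (ϑ (t + π / 2)) - cos (circAngle k t)| := by
      rw [abs_sub_comm (cos (ϑ (t + π / 2)))]
      refine le_trans (le_of_eq ?_) (abs_add_le _ _)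
      congr 1; ring
    nlinarith [mul_nonneg hN₁0 e0, mul_nonneg hC e0]

lemma exists_contDiff_eq_div_sq {K : ℝ × ℝ → ℝ} (hK : ContDiffOn ℝ 1 K {z : ℝ × ℝ | 0 < z.2})
    {y₀ : ℝ} (hy₀ : 0 < y₀) :
    ∃ κ : ℝ × ℝ → ℝ, ContDiff ℝ 1 κ ∧ ∀ p, y₀ ≤ p.2 → κ p = K p / p.2 ^ 2 := by
  refine ⟨fun p => Real.smoothTransition (2 * p.2 / y₀ - 1) * (K p / p.2 ^ 2), ?_, fun p hp => ?_⟩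
  · refine contDiff_iff_contDiffAt.2 fun p => ?_
    rcases lt_or_ge p.2 (y₀ / 2) with h | h
    · have : (fun p : ℝ × ℝ => Real.smoothTransition (2 * p.2 / y₀ - 1) * (K p / p.2 ^ 2))
          =ᶠ[𝓝 p] fun _ => 0 := by
        filter_upwards [(isOpen_lt continuous_snd continuous_const).mem_nhds h] with x hx
        rw [Real.smoothTransition.zero_of_nonpos, zero_mul]
        have : 2 * x.2 / y₀ ≤ 1 := (div_le_one hy₀).2 (by linarith [show x.2 < y₀ / 2 from hx])
        linarith
      exact contDiffAt_const.congr_of_eventuallyEq this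
    · have hp : 0 < p.2 := by linarith
      have hKp : ContDiffAt ℝ 1 K p :=
        hK.contDiffAt ((isOpen_lt continuous_const continuous_snd).mem_nhds hp)
      refine ContDiffAt.mul ?_ (hKp.div (contDiffAt_snd.pow 2) (by positivity))
      exact (Real.smoothTransition.contDiff.comp
        (((contDiff_const.mul contDiff_snd).div_const y₀).sub contDiff_const)).contDiffAt
  · simp only
    rw [Real.smoothTransition.one_of_one_le, one_mul]
    have : 2 ≤ 2 * p.2 / y₀ := (le_div_iff₀ hy₀).2 (by linarith)
    linarith

lemma exists_abs_comp_circPt_le {κ : ℝ × ℝ → ℝ} (hκ : Continuous κ) {W : Set (ℝ × ℝ)}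
    (hW : IsCompact W) (k R : ℝ) :
    ∃ M : ℝ, 0 ≤ M ∧ ∀ t, ∀ a ∈ W, |κ (circPt k R t a) * (circPt k R t a).2 ^ 2| ≤ M := by
  have hS : IsCompact (Set.Icc (-1 : ℝ) 1 ×ˢ Set.Icc (-1 : ℝ) 1 ×ˢ W) :=
    isCompact_Icc.prod (isCompact_Icc.prod hW)
  obtain ⟨M, hM⟩ := hS.exists_bound_of_continuousOn (f := fun x : ℝ × ℝ × (ℝ × ℝ) =>
    κ (x.2.2.1 + R * x.2.2.2 * x.2.1, R * x.2.2.2 * (k - x.1)) * (R * x.2.2.2 * (k - x.1)) ^ 2)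
    (by fun_prop)
  refine ⟨max M 0, le_max_right _ _, fun t a ha => le_max_of_le_left ?_⟩
  exact hM (cos t, sin t, a) ⟨⟨neg_one_le_cos t, cos_le_one t⟩, ⟨neg_one_le_sin t, sin_le_one t⟩, ha⟩

lemma exists_box {S : Set (ℝ × ℝ)} (hS : IsCompact S) (hSpos : S ⊆ {z : ℝ × ℝ | 0 < z.2}) :
    ∃ m M : ℝ, 0 < m ∧ 0 ≤ M ∧ m ≤ M ∧ ∀ z ∈ S, |z.1| ≤ M ∧ m ≤ z.2 ∧ z.2 ≤ M := by
  obtain ⟨B, hB⟩ := hS.isBounded.exists_norm_le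
  obtain ⟨m, hm, hmS⟩ : ∃ m : ℝ, 0 < m ∧ ∀ z ∈ S, m ≤ z.2 := by
    rcases S.eq_empty_or_nonempty with rfl | hne
    · exact ⟨1, one_pos, fun z hz => hz.elim⟩
    · obtain ⟨z, hz, h⟩ := hS.exists_isMinOn hne continuous_snd.continuousOn
      exact ⟨z.2, hSpos hz, fun w hw => h hw⟩
  refine ⟨m, max B m, hm, hm.le.trans (le_max_right _ _), le_max_right _ _, fun z hz =>
    ⟨?_, hmS z hz, ?_⟩⟩
  · exact ((norm_fst_le z).trans (hB z hz)).trans (le_max_left _ _)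
  · exact ((le_abs_self _).trans ((norm_snd_le z).trans (hB z hz))).trans (le_max_left _ _)

/-- Retraction of the plane onto a box. -/
lemma exists_retraction_box {a b c d : ℝ} (hab : a ≤ b) (hcd : c ≤ d) :
    ∃ pr : ℝ × ℝ → ℝ × ℝ, (∀ x, pr x ∈ Set.Icc a b ×ˢ Set.Icc c d) ∧
      (∀ x ∈ Set.Icc a b ×ˢ Set.Icc c d, pr x = x) ∧ ∀ x y, ‖pr x - pr y‖ ≤ ‖x - y‖ := by
  refine ⟨fun x => (Set.projIcc a b hab x.1, Set.projIcc c d hcd x.2),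
    fun x => ⟨(Set.projIcc a b hab x.1).2, (Set.projIcc c d hcd x.2).2⟩, fun x hx => ?_,
    fun x y => ?_⟩
  · simp only [Set.projIcc_of_mem hab hx.1, Set.projIcc_of_mem hcd hx.2]
  · refine max_le ((LipschitzWith.projIcc hab).dist_le_mul x.1 y.1 |>.trans ?_)
      ((LipschitzWith.projIcc hcd).dist_le_mul x.2 y.2 |>.trans ?_)
    · simpa [dist_eq_norm] using norm_fst_le (x - y)
    · simpa [dist_eq_norm] using norm_snd_le (x - y)

/-- Existence of embedded loops near the reference circles whose centers are nearly critical
for the Melnikov function. -/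
theorem exists_loops_near {k : ℝ} (hk : 1 < k) {K : ℝ × ℝ → ℝ}
    (hK : ContDiffOn ℝ 1 K {z : ℝ × ℝ | 0 < z.2}) {A : Set (ℝ × ℝ)}
    (hAc : IsCompact (closure A)) (hAH : closure A ⊆ {z : ℝ × ℝ | 0 < z.2})
    (hstab : HasStableCriticalPt (Fmel k K) A) :
    (∀ z ∈ closure A, ContinuousAt (fderiv ℝ (Fmel k K)) z) ∧
    ∃ ε₀ > (0 : ℝ), ∃ N : ℝ, ∀ ε : ℝ, |ε| < ε₀ → ∃ (u : ℝ → ℝ × ℝ) (z : ℝ × ℝ),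
      z ∈ A ∧ ‖fderiv ℝ (Fmel k K) z‖ ≤ N * |ε| ∧
      IsKLoop (fun z => k + ε * K z) u ∧ IsEmbedded u ∧ HasJetNear k (N * |ε|) z u := by
  obtain ⟨r, hr, hstab⟩ := hstab
  have hR := Rk_pos hk
  obtain ⟨m, M, hm, hM, hmM, hbox⟩ := exists_box hAc hAH
  set V : Set (ℝ × ℝ) := Set.Ioo (-(M + 1)) (M + 1) ×ˢ Set.Ioo (m / 2) (M + 1) with hV
  set W : Set (ℝ × ℝ) :=
    Set.Icc (-(M + 1) - m / 4) (M + 1 + m / 4) ×ˢ Set.Icc (m / 4) (M + 1 + m / 4) with hW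
  have hVo : IsOpen V := isOpen_Ioo.prod isOpen_Ioo
  have hAV : closure A ⊆ V := fun z hz => by
    obtain ⟨h1, h2, h3⟩ := hbox z hz
    rw [abs_le] at h1
    exact ⟨⟨by linarith, by linarith⟩, ⟨by linarith, by linarith⟩⟩
  have hWm : ∀ a ∈ W, m / 4 ≤ a.2 := fun a ha => ha.2.1
  have hWc : IsCompact W := isCompact_Icc.prod isCompact_Icc
  have hVW : ∀ z ∈ V, ∀ a, ‖a - z‖ ≤ m / 4 → a ∈ W := fun z hz a ha => by
    have h1 := abs_le.1 ((norm_fst_le (a - z)).trans ha)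
    have h2 := abs_le.1 ((norm_snd_le (a - z)).trans ha)
    simp only [Prod.fst_sub, Prod.snd_sub] at h1 h2
    obtain ⟨⟨h3, h4⟩, h5, h6⟩ := hz
    exact ⟨⟨by linarith, by linarith⟩, by linarith, by linarith⟩
  set y₀ : ℝ := (k - 1) * Rk k * (m / 4) with hy₀
  have hk0 : 0 < k - 1 := by linarith
  have hy₀pos : 0 < y₀ := by positivity
  obtain ⟨κ, hκ, hκK⟩ := exists_contDiff_eq_div_sq hK hy₀pos
  have hcirc : ∀ t, ∀ a ∈ W, y₀ ≤ (circPt k (Rk k) t a).2 := fun t a ha => by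
    have h1 : k - 1 ≤ k - cos t := by linarith [cos_le_one t]
    have h2 := hWm a ha
    have h3 : 0 < a.2 := by linarith
    calc y₀ = Rk k * (m / 4) * (k - 1) := by rw [hy₀]; ring
      _ ≤ Rk k * a.2 * (k - cos t) := by gcongr
  have hκP : ∀ t, ∀ a ∈ W, κ (circPt k (Rk k) t a) * (circPt k (Rk k) t a).2 ^ 2
      = K (circPt k (Rk k) t a) := fun t a ha => by
    have h1 := hcirc t a ha
    have h2 : (circPt k (Rk k) t a).2 ≠ 0 := (hy₀pos.trans_le h1).ne'
    rw [hκK _ h1, div_mul_cancel₀ _ (pow_ne_zero 2 h2)]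
  obtain ⟨MK, hMK, hMKb⟩ := exists_abs_comp_circPt_le hκ.continuous hWc k (Rk k)
  have hFeq : Set.EqOn (Fmel k K) (circAction k (Rk k) κ) V := fun z hz => by
    have h1 : m / 4 ≤ z.2 := by linarith [hz.2.1]
    exact Fmel_eq_circAction hκ hκK (by linarith) (by rw [hy₀]; gcongr) hR
  have hFd : ∀ z ∈ V, fderiv ℝ (Fmel k K) z = fderiv ℝ (circAction k (Rk k) κ) z := fun z hz =>
    (hFeq.eventuallyEq_of_mem (hVo.mem_nhds hz)).fderiv_eq
  obtain ⟨pr, hprW, hprid, hprl⟩ := exists_retraction_box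
    (a := -(M + 1) - m / 4) (b := M + 1 + m / 4) (c := m / 4) (d := M + 1 + m / 4)
    (by linarith) (by linarith)
  have hz₁ : ((0 : ℝ), m) ∈ V := ⟨⟨by simp; linarith, by simp; linarith⟩, by simp [hm],
    by simp; linarith⟩
  obtain ⟨hact, ε₁, hε₁, C, hC, hred⟩ := exists_reduction (k := k) hR hκ hVo
    ((convex_Ioo _ _).prod (convex_Ioo _ _)) hWc ((convex_Icc _ _).prod (convex_Icc _ _))
    (by positivity : 0 < m / 4) hWm (by positivity : 0 < m / 4) hVW hz₁ hprW hprid hprl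
  have hFC : ContDiffOn ℝ 1 (Fmel k K) V := hact.congr hFeq
  refine ⟨fun z hz => (hFC.continuousOn_fderiv_of_isOpen hVo le_rfl).continuousAt
    (hVo.mem_nhds (hAV hz)), ?_⟩
  obtain ⟨N, hN, hloop⟩ := exists_embedded_loop_of_center hk hMK hC.le
  refine ⟨min ε₁ (min 1 (r / (2 * C))), by positivity, max N C, fun ε hε => ?_⟩
  obtain ⟨hεa, hεb, hεc⟩ : |ε| < ε₁ ∧ |ε| < 1 ∧ |ε| < r / (2 * C) := by simpa using hε
  have hmono : ∀ {x}, HasJetNear k (N * |ε|) x ≤ HasJetNear k (max N C * |ε|) x := by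
    rintro x u ⟨L, φ, a, D, h1, h2, h3, h4, h5⟩
    have h : N * |ε| ≤ max N C * |ε| :=
      mul_le_mul_of_nonneg_right (le_max_left _ _) (abs_nonneg ε)
    exact ⟨L, φ, a, D, h1, h2.trans h, fun t => (h3 t).trans h, fun t => (h4 t).trans h,
      fun t => (h5 t).trans h⟩
  have hCN : C * |ε| ≤ max N C * |ε| :=
    mul_le_mul_of_nonneg_right (le_max_right _ _) (abs_nonneg ε)
  have hmain : ∃ z ∈ A, ‖fderiv ℝ (Fmel k K) z‖ ≤ C * |ε| ∧
      ∃ q : ℝ → ℝ × ℝ, Function.Periodic q (2 * π) ∧ (∀ t, q t ∈ W) ∧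
        (∀ t, ‖q t - z‖ ≤ C * |ε|) ∧
        (∀ t, 1 / 2 ≤ 1 + ε * (κ (circPt k (Rk k) t (q t)) * (k - cos t)
          * (Rk k * (q t).2) ^ 2)) ∧
        ∀ t, HasDerivAt q
          (ε • (normFactor k (Rk k) κ ε t (q t) • forcing k (Rk k) κ t (q t))) t := by
    rcases eq_or_ne ε 0 with rfl | hε0
    · obtain ⟨z, hz, hz0⟩ := hstab (Fmel k K) ⟨V, hVo, hAV, hFC⟩ fun z _ => by simpa using hr
      refine ⟨z, hz, by simp [hz0], fun _ => z, fun _ => rfl,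
        fun _ => hVW z (hAV (subset_closure hz)) z (by simp; linarith), by simp, fun _ => by norm_num,
        fun t => (hasDerivAt_const t z).congr_deriv (by simp)⟩
    · obtain ⟨G, hG, hG0, hG1, hGq⟩ := hred ε hε0 hεa.le
      obtain ⟨z, hz, hz0⟩ := hstab G ⟨V, hVo, hAV, hG⟩ fun z hz => by
        have h1 := hG0 z (hAV hz)
        have h2 := hG1 z (hAV hz)
        rw [← hFeq (hAV hz)] at h1
        rw [← hFd z (hAV hz)] at h2
        rw [lt_div_iff₀ (by positivity)] at hεc
        linarith
      have hzV := hAV (subset_closure hz)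
      refine ⟨z, hz, ?_, hGq z hzV hz0⟩
      have := hG1 z hzV
      rwa [hz0, zero_sub, norm_neg, ← hFd z hzV] at this
  obtain ⟨z, hz, hzd, q, hqp, hqW, hqz, hhalf, hq⟩ := hmain
  obtain ⟨u, hu1, hu2, hu3⟩ := hloop ε K κ q z hεb.le hκ.continuous hqp
    (fun t => by linarith [hWm _ (hqW t)]) (fun t => hκP t _ (hqW t))
    (fun t => by rw [← hκP t _ (hqW t)]; exact hMKb t _ (hqW t)) hhalf hq hqz
  exact ⟨u, z, hz, hzd.trans hCN, hu1, hu2, hmono _ hu3⟩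

/-- main theorem: if the Melnikov function `F_k^K` has a stable critical
point in an open set `A ⋐ H²`, then for all `ε` near `0` there is an embedded
`(k+εK)`-loop `u^ε`; moreover any sequence `ε_h → 0` has a subsequence along which `u^ε`
converges in C², uniformly with two derivatives, to `ω_{z₀}` for some critical point
`z₀ ∈ cl A` of `F_k^K`. -/
theorem stmt_13 (k : ℝ) (hk : 1 < k) (K : (ℝ × ℝ) → ℝ)
    (hK : ContDiffOn ℝ 1 K {z : ℝ × ℝ | 0 < z.2})
    (A : Set (ℝ × ℝ)) (hAo : IsOpen A) (hAc : IsCompact (closure A))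
    (hAH : closure A ⊆ {z : ℝ × ℝ | 0 < z.2})
    (hstab : HasStableCriticalPt (Fmel k K) A) :
    ∃ ε₀ > (0:ℝ), ∃ u : ℝ → ℝ → ℝ × ℝ,
      (∀ ε : ℝ, |ε| < ε₀ →
        IsKLoop (fun z => k + ε * K z) (u ε) ∧ IsEmbedded (u ε)) ∧
      (∀ εh : ℕ → ℝ, Tendsto εh atTop (𝓝 0) → (∀ h, |εh h| < ε₀) →
        ∃ φ : ℕ → ℕ, StrictMono φ ∧
          ∃ z₀ ∈ closure A, fderiv ℝ (Fmel k K) z₀ = 0 ∧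
            ∀ δ > (0:ℝ), ∃ N : ℕ, ∀ j ≥ N, ∀ t : ℝ,
              enorm2 (u (εh (φ j)) t - omz k z₀ t)
                + enorm2 (deriv (u (εh (φ j))) t - deriv (omz k z₀) t)
                + enorm2 (deriv (deriv (u (εh (φ j)))) t - deriv (deriv (omz k z₀)) t)
              < δ) := by
  obtain ⟨hcont, ε₀, hε₀, N, h⟩ := exists_loops_near hk hK hAc hAH hstab
  choose! u zc hzA hzd huK huE huJ using h
  refine ⟨ε₀, hε₀, u, fun ε hε => ⟨huK ε hε, huE ε hε⟩, fun εh hεh hlt => ?_⟩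
  obtain ⟨z₀, hz₀, φ, hφ, hlim⟩ := hAc.tendsto_subseq fun h => subset_closure (hzA _ (hlt h))
  have hNε : Tendsto (fun j => N * |εh (φ j)|) atTop (𝓝 0) := by
    have := (hεh.comp hφ.tendsto_atTop).abs.const_mul N
    simpa using this
  refine ⟨φ, hφ, z₀, hz₀, ?_, fun δ hδ => ?_⟩
  · exact tendsto_nhds_unique ((hcont z₀ hz₀).tendsto.comp hlim)
      (squeeze_zero_norm (fun j => hzd _ (hlt (φ j))) hNε)
  · obtain ⟨η, hη, hclose⟩ := exists_dist_angleJet_lt k z₀ (by positivity : 0 < δ / 6)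
    have hev := (hNε.eventually (gt_mem_nhds (half_pos hη))).and
      (hlim.eventually (Metric.ball_mem_nhds z₀ (half_pos hη)))
    obtain ⟨n, hn⟩ := eventually_atTop.1 hev
    refine ⟨n, fun j hj t => enorm2_add_lt_of_dist_lt ?_⟩
    obtain ⟨h1, h2⟩ := hn j hj
    obtain ⟨L, ψ, a, D, hjet, hL, hψ, ha, hD⟩ := huJ _ (hlt (φ j))
    rw [hjet, jet_omz hk (hAH hz₀)]
    refine hclose _ _ _ _ _ (by linarith) (by linarith [hψ t]) ?_ (by linarith [hD t])
    have h3 : ‖zc (εh (φ j)) - z₀‖ < η / 2 := by rwa [← dist_eq_norm]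
    have h4 := norm_sub_le_norm_sub_add_norm_sub (a t) (zc (εh (φ j))) z₀
    linarith [ha t]
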